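/- Let T ⊂ ℙ²(ℝ) be a set of exactly 8 points such that no 4 points of T lie on a line and no 7 points of T lie on a conic. Let P₆(T) be the set of psd sextic forms vanishing at every point of T, and Σ₆(T) the set of sos forms in P₆(T). Then the ℝ-linear span of P₆(T) equals I₆(2T) and has dimension 4, while the ℝ-linear span of Σ₆(T) equals I₃(T)² and has dimension 3. -/

import Mathlib

open MvPolynomial

noncomputable section

/-- The real projective plane, as lines through the origin of `ℝ³`. -/
abbrev P2 := Projectivization ℝ (Fin 3 → ℝ)

/-- A polynomial is psd if it takes only nonnegative values on `ℝ³`. -/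
def Psd (g : MvPolynomial (Fin 3) ℝ) : Prop := ∀ u : Fin 3 → ℝ, 0 ≤ eval u g

/-- A polynomial is sos if it is a finite sum of squares. -/
def Sos (g : MvPolynomial (Fin 3) ℝ) : Prop :=
  ∃ (n : ℕ) (h : Fin n → MvPolynomial (Fin 3) ℝ), g = ∑ i, (h i) ^ 2

/-- A form vanishes at a point of `ℙ²(ℝ)` if it vanishes at a representative vector. -/
def VanishAt (g : MvPolynomial (Fin 3) ℝ) (P : P2) : Prop := eval P.rep g = 0

/-- A form is singular at a point of `ℙ²(ℝ)` if it and all its first partial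
derivatives vanish at a representative vector. -/
def SingAt (g : MvPolynomial (Fin 3) ℝ) (P : P2) : Prop :=
  eval P.rep g = 0 ∧ ∀ i, eval P.rep (pderiv i g) = 0

/-- `I_d(T)`: the space of degree-`d` forms vanishing at every point of `T`. -/
def Isub (d : ℕ) (T : Set P2) : Submodule ℝ (MvPolynomial (Fin 3) ℝ) :=
  (homogeneousSubmodule (Fin 3) ℝ d) ⊓
  { carrier := {f | ∀ P ∈ T, VanishAt f P}
    zero_mem' := by intro P _; simp [VanishAt]
    add_mem' := by
      intro a b ha hb P hP
      have h1 := ha P hP; have h2 := hb P hP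
      unfold VanishAt at *; simp [h1, h2]
    smul_mem' := by
      intro c f hf P hP
      have h1 := hf P hP
      unfold VanishAt at *; simp [smul_eq_C_mul, h1] }

/-- `I_d(2T)`: the space of degree-`d` forms singular at every point of `T`. -/
def Isub2 (d : ℕ) (T : Set P2) : Submodule ℝ (MvPolynomial (Fin 3) ℝ) :=
  (homogeneousSubmodule (Fin 3) ℝ d) ⊓
  { carrier := {f | ∀ P ∈ T, SingAt f P}
    zero_mem' := by intro P _; constructor <;> simp [SingAt]
    add_mem' := by
      intro a b ha hb P hP
      obtain ⟨h1, h2⟩ := ha P hP; obtain ⟨h3, h4⟩ := hb P hP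
      exact ⟨by simp [h1, h3], fun i => by simp [h2 i, h4 i]⟩
    smul_mem' := by
      intro c f hf P hP
      obtain ⟨h1, h2⟩ := hf P hP
      refine ⟨by simp [smul_eq_C_mul, h1], fun i => ?_⟩
      have := h2 i
      simp [smul_eq_C_mul, this] }

/-- `I₃(T)²`: the span of products of two cubics vanishing on `T`. -/
def IsqCubic (T : Set P2) : Submodule ℝ (MvPolynomial (Fin 3) ℝ) :=
  Submodule.span ℝ {h | ∃ f₁ ∈ Isub 3 T, ∃ f₂ ∈ Isub 3 T, h = f₁ * f₂}

/-- No 4 points of `T` on a line, no 7 on a conic. -/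
def GenPos (T : Set P2) : Prop :=
  (∀ l : MvPolynomial (Fin 3) ℝ, l ≠ 0 → l.IsHomogeneous 1 →
    {P ∈ T | VanishAt l P}.encard ≤ 3) ∧
  (∀ c : MvPolynomial (Fin 3) ℝ, c ≠ 0 → c.IsHomogeneous 2 →
    {P ∈ T | VanishAt c P}.encard ≤ 6)

/-- The real projective zero set of `g`. -/
def VR (g : MvPolynomial (Fin 3) ℝ) : Set P2 := {P | VanishAt g P}

section

abbrev RR := MvPolynomial (Fin 3) ℝ
abbrev V3 := Fin 3 → ℝ
abbrev HH (d : ℕ) : Submodule ℝ RR := homogeneousSubmodule (Fin 3) ℝ d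

instance HH_fin (d : ℕ) : Module.Finite ℝ (HH d) :=
  Module.Finite.iff_fg.2 (homogeneousSubmodule_fg _ _ d)

lemma finrank_HH (d : ℕ) : Module.finrank ℝ (HH d) = (d + 2).choose 2 := by
  have h := homogeneousSubmodule_eq_finsupp_supported (Fin 3) ℝ d
  have e : {s : Fin 3 →₀ ℕ | s.degree = d} =
      ((Finset.univ : Finset (Fin 3)).finsuppAntidiag d : Set (Fin 3 →₀ ℕ)) := by
    ext s
    simp [Finset.mem_finsuppAntidiag, Finsupp.degree_eq_sum]
  have e2 := (AddMonoidAlgebra.supportedEquivFinsupp (S := ℝ) (R := ℝ)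
    {s : Fin 3 →₀ ℕ | s.degree = d})
  unfold HH
  rw [h]
  have h4 := e2.finrank_eq
  refine Eq.trans h4 ?_
  have : Fintype {s : Fin 3 →₀ ℕ | s.degree = d} := by
    rw [e]; infer_instance
  rw [Module.finrank_finsupp_self, ← Nat.card_eq_fintype_card, e, Nat.card_coe_set_eq,
    Set.ncard_coe_finset]
  rw [Finset.card_finsuppAntidiag_nat_eq_choose]
  simp
  rw [Nat.add_comm 2 d, Nat.choose_symm_add]

/-- evaluation as a linear functional -/
def evL (u : V3) : RR →ₗ[ℝ] ℝ := (aeval u : RR →ₐ[ℝ] ℝ).toLinearMap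

@[simp] lemma evL_apply (u : V3) (f : RR) : evL u f = eval u f := by
  simp [evL, MvPolynomial.aeval_eq_eval]

/-- forms of degree d vanishing at a family of points -/
def JJ {ι : Type*} (d : ℕ) (q : ι → V3) : Submodule ℝ RR :=
  HH d ⊓ LinearMap.ker (LinearMap.pi fun i => evL (q i))

lemma mem_JJ {ι : Type*} {d : ℕ} {q : ι → V3} {f : RR} :
    f ∈ JJ d q ↔ f.IsHomogeneous d ∧ ∀ i, eval (q i) f = 0 := by
  simp [JJ, LinearMap.mem_ker, funext_iff, mem_homogeneousSubmodule]

instance JJ_fin {ι : Type*} (d : ℕ) (q : ι → V3) : Module.Finite ℝ (JJ d q) :=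
  Submodule.finiteDimensional_of_le (inf_le_left : JJ d q ≤ HH d)

lemma ker_ge {W : Type*} [AddCommGroup W] [Module ℝ W] [Module.Finite ℝ W] (d : ℕ)
    (L : RR →ₗ[ℝ] W) :
    Module.finrank ℝ (HH d) ≤ Module.finrank ℝ ↥(HH d ⊓ LinearMap.ker L) + Module.finrank ℝ W := by
  have h := (L.domRestrict (HH d)).finrank_range_add_finrank_ker
  have h1 := Submodule.finrank_le (LinearMap.range (L.domRestrict (HH d)))
  have h2 : Module.finrank ℝ (LinearMap.ker (L.domRestrict (HH d))) =
      Module.finrank ℝ ↥(HH d ⊓ LinearMap.ker L) := by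
    rw [LinearMap.ker_domRestrict, ← Submodule.finrank_map_subtype_eq, Submodule.map_comap_subtype]
  omega

lemma ker_eq {W : Type*} [AddCommGroup W] [Module ℝ W] [Module.Finite ℝ W] (d : ℕ)
    (L : RR →ₗ[ℝ] W) (hs : ∀ w, ∃ g ∈ HH d, L g = w) :
    Module.finrank ℝ (HH d) = Module.finrank ℝ ↥(HH d ⊓ LinearMap.ker L) + Module.finrank ℝ W := by
  have h := (L.domRestrict (HH d)).finrank_range_add_finrank_ker
  have h1 : LinearMap.range (L.domRestrict (HH d)) = ⊤ := by
    rw [LinearMap.range_eq_top]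
    intro w
    obtain ⟨g, hg, h⟩ := hs w
    exact ⟨⟨g, hg⟩, h⟩
  have h2 : Module.finrank ℝ (LinearMap.ker (L.domRestrict (HH d))) =
      Module.finrank ℝ ↥(HH d ⊓ LinearMap.ker L) := by
    rw [LinearMap.ker_domRestrict, ← Submodule.finrank_map_subtype_eq, Submodule.map_comap_subtype]
  rw [h1, finrank_top] at h
  omega

lemma JJ_ge {ι : Type*} [Fintype ι] (d : ℕ) (q : ι → V3) :
    Module.finrank ℝ (HH d) ≤ Module.finrank ℝ (JJ d q) + Fintype.card ι := by
  have := ker_ge d (LinearMap.pi fun i => evL (q i))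
  rwa [Module.finrank_fintype_fun_eq_card] at this

lemma JJ_eq {ι : Type*} [Fintype ι] (d : ℕ) (q : ι → V3)
    (hd : ∀ i, ∃ g : RR, g.IsHomogeneous d ∧ eval (q i) g ≠ 0 ∧ ∀ j, j ≠ i → eval (q j) g = 0) :
    Module.finrank ℝ (HH d) = Module.finrank ℝ (JJ d q) + Fintype.card ι := by
  classical
  have := ker_eq d (LinearMap.pi fun i => evL (q i)) (by
    choose g h1 h2 h3 using hd
    intro w
    refine ⟨∑ i, (w i / eval (q i) (g i)) • g i, ?_, ?_⟩
    · exact Submodule.sum_mem _ fun i _ => Submodule.smul_mem _ _ (h1 i)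
    · ext j
      simp only [map_sum, map_smul, Finset.sum_apply, Pi.smul_apply, LinearMap.pi_apply, evL_apply]
      rw [Finset.sum_eq_single j]
      · simp [h2 j]
      · intro i _ hij
        simp [h3 i j hij.symm]
      · simp)
  rwa [Module.finrank_fintype_fun_eq_card] at this

/-- linear forms -/
def LL (a : V3) : RR := ∑ i, C (a i) * X i

lemma LL_hom (a : V3) : (LL a).IsHomogeneous 1 := by
  apply IsHomogeneous.sum
  intro i _
  exact (isHomogeneous_X ℝ i).C_mul (a i)

@[simp] lemma eval_LL (a u : V3) : eval u (LL a) = a ⬝ᵥ u := by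
  simp [LL, dotProduct]

lemma LL_ne {a : V3} (h : a ≠ 0) : LL a ≠ 0 := by
  intro h0
  apply h
  rw [← dotProduct_self_eq_zero, ← eval_LL, h0, map_zero]

/-- directional derivative -/
def DD (v : V3) : Derivation ℝ RR RR := mkDerivation ℝ (fun i => C (v i))

lemma DD_eq (v : V3) (f : RR) : DD v f = ∑ i, C (v i) * pderiv i f := by
  have : DD v = (C (v 0) : RR) • (pderiv 0 : Derivation ℝ RR RR) +
      (C (v 1) : RR) • (pderiv 1 : Derivation ℝ RR RR) +
      (C (v 2) : RR) • (pderiv 2 : Derivation ℝ RR RR) := by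
    apply derivation_ext
    intro i
    fin_cases i <;> simp [DD, mkDerivation_X, pderiv_X, Pi.single_apply]
  rw [this]
  simp [Fin.sum_univ_three]

@[simp] lemma DD_LL (v a : V3) : DD v (LL a) = C (a ⬝ᵥ v) := by
  simp [DD, LL, mkDerivation_X, dotProduct]

@[simp] lemma DD_X (v : V3) (i : Fin 3) : DD v (X i) = C (v i) := by
  simp [DD, mkDerivation_X]

lemma eval_DD (v u : V3) (f : RR) : eval u (DD v f) = ∑ i, v i * eval u (pderiv i f) := by
  simp [DD_eq]

lemma euler {f : RR} {n : ℕ} (hf : f.IsHomogeneous n) (u : V3) :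
    eval u (DD u f) = n * eval u f := by
  rw [eval_DD]
  have := congrArg (eval u) hf.sum_X_mul_pderiv
  simpa using this

lemma eval_smul_hom {f : RR} {n : ℕ} (hf : f.IsHomogeneous n) (c : ℝ) (u : V3) :
    eval (c • u) f = c ^ n * eval u f := by
  rw [show c • u = fun i => c * u i from rfl]
  rw [eval_eq', eval_eq', Finset.mul_sum]
  apply Finset.sum_congr rfl
  intro s hs
  have h := hf (mem_support_iff.1 hs)
  have h2 : s.degree = n := by rw [← h, Finsupp.degree_eq_weight_one]; rfl
  rw [Finsupp.degree_eq_sum] at h2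
  simp only [mul_pow, Finset.prod_mul_distrib]
  rw [Finset.prod_pow_eq_pow_sum, h2]
  ring

end

section

/-- grading homomorphism -/
def gr : RR →ₐ[ℝ] Polynomial RR := aeval (fun i => Polynomial.C (X i) * Polynomial.X)

lemma gr_monomial (s : Fin 3 →₀ ℕ) (a : ℝ) :
    gr (monomial s a) = Polynomial.monomial s.degree (monomial s a) := by
  rw [gr, aeval_monomial, Finsupp.prod_fintype _ _ (by simp), monomial_eq (s := s),
    Finsupp.prod_fintype _ _ (by simp), Finsupp.degree_eq_sum]
  rw [← Polynomial.C_mul_X_pow_eq_monomial]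
  simp only [mul_pow, Finset.prod_mul_distrib, map_mul, map_prod, map_pow]
  rw [Finset.prod_pow_eq_pow_sum]
  rw [Polynomial.algebraMap_apply]
  simp only [algebraMap_eq]
  ring

lemma gr_coeff (f : RR) (k : ℕ) : (gr f).coeff k = homogeneousComponent k f := by
  induction f using MvPolynomial.induction_on' with
  | monomial s a =>
    rw [gr_monomial, Polynomial.coeff_monomial,
      homogeneousComponent_of_mem (n := s.degree) (isHomogeneous_monomial a rfl)]
    simp [eq_comm]
  | add p q hp hq => simp only [map_add, Polynomial.coeff_add, hp, hq]

lemma gr_hom {f : RR} {n : ℕ} (hf : f.IsHomogeneous n) : gr f = Polynomial.monomial n f := by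
  ext1 k
  rw [gr_coeff, Polynomial.coeff_monomial, homogeneousComponent_of_mem hf]
  simp [eq_comm]

lemma hom_of_comp {f : RR} {n : ℕ} (h : ∀ k, k ≠ n → homogeneousComponent k f = 0) :
    f.IsHomogeneous n := by
  have h1 := sum_homogeneousComponent f
  rw [← h1]
  apply IsHomogeneous.sum
  intro k _
  by_cases hk : k = n
  · subst hk; exact homogeneousComponent_isHomogeneous _ _
  · rw [h k hk]; exact isHomogeneous_zero _ _ _

lemma gr_ne {f : RR} (hf : f ≠ 0) : gr f ≠ 0 := by
  intro h
  apply hf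
  rw [← sum_homogeneousComponent f]
  apply Finset.sum_eq_zero
  intro k _
  rw [← gr_coeff, h, Polynomial.coeff_zero]

lemma factor_hom {f g : RR} {n : ℕ} (h0 : f * g ≠ 0) (h : (f * g).IsHomogeneous n) :
    ∃ k l, k + l = n ∧ f.IsHomogeneous k ∧ g.IsHomogeneous l := by
  have hf := left_ne_zero_of_mul h0
  have hg := right_ne_zero_of_mul h0
  have e : gr f * gr g = Polynomial.monomial n (f * g) := by rw [← map_mul, gr_hom h]
  have h1 := congrArg Polynomial.natDegree e
  have h2 := congrArg Polynomial.natTrailingDegree e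
  rw [Polynomial.natDegree_mul (gr_ne hf) (gr_ne hg), Polynomial.natDegree_monomial_eq _ h0] at h1
  rw [Polynomial.natTrailingDegree_mul (gr_ne hf) (gr_ne hg),
    Polynomial.natTrailingDegree_monomial h0] at h2
  have h3 := Polynomial.natTrailingDegree_le_natDegree (gr f)
  have h4 := Polynomial.natTrailingDegree_le_natDegree (gr g)
  refine ⟨(gr f).natDegree, (gr g).natDegree, h1, ?_, ?_⟩
  · apply hom_of_comp
    intro k hk
    rw [← gr_coeff]
    rcases lt_or_gt_of_ne hk with h | h
    · exact Polynomial.coeff_eq_zero_of_lt_natTrailingDegree (by omega)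
    · exact Polynomial.coeff_eq_zero_of_natDegree_lt h
  · apply hom_of_comp
    intro k hk
    rw [← gr_coeff]
    rcases lt_or_gt_of_ne hk with h | h
    · exact Polynomial.coeff_eq_zero_of_lt_natTrailingDegree (by omega)
    · exact Polynomial.coeff_eq_zero_of_natDegree_lt h

lemma sq_step {n m : ℕ} (q : Fin n → Polynomial ℝ) (c : ℝ)
    (h : ∑ i, q i ^ 2 = Polynomial.C c * Polynomial.X ^ (m + 2)) :
    ∃ r : Fin n → Polynomial ℝ, (∀ i, q i = Polynomial.X * r i) ∧
      ∑ i, r i ^ 2 = Polynomial.C c * Polynomial.X ^ m := by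
  have h1 : ∀ i, Polynomial.X ∣ q i := by
    intro i
    rw [Polynomial.X_dvd_iff, Polynomial.coeff_zero_eq_eval_zero]
    have := congrArg (Polynomial.eval 0) h
    simp only [Polynomial.eval_finsetSum, Polynomial.eval_pow, Polynomial.eval_mul, 
      Polynomial.eval_X] at this
    rw [zero_pow (by omega), mul_zero, Finset.sum_eq_zero_iff_of_nonneg (fun i _ => sq_nonneg _)] at this
    simpa using this i (Finset.mem_univ i)
  choose r hr using h1
  refine ⟨r, hr, ?_⟩
  apply mul_left_cancel₀ (pow_ne_zero 2 (Polynomial.X_ne_zero (R := ℝ)))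
  rw [Finset.mul_sum, ← mul_assoc, mul_comm _ (Polynomial.C c), mul_assoc, ← pow_add, add_comm 2, ← h]
  apply Finset.sum_congr rfl
  intro i _
  rw [hr i]; ring

lemma sq_const {n : ℕ} (q : Fin n → Polynomial ℝ) (c : ℝ)
    (h : ∑ i, q i ^ 2 = Polynomial.C c) (i : Fin n) : ∃ b, q i = Polynomial.C b := by
  refine ⟨(q i).coeff 0, Polynomial.eq_C_of_degree_le_zero ?_⟩
  rw [← Polynomial.isBoundedUnder_abs_atTop_iff]
  refine ⟨max c 1, Filter.eventually_map.2 (Filter.Eventually.of_forall ?_)⟩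
  intro x
  have := congrArg (Polynomial.eval x) h
  simp only [Polynomial.eval_finsetSum, Polynomial.eval_pow, Polynomial.eval_C] at this
  have h2 : Polynomial.eval x (q i) ^ 2 ≤ c := by
    rw [← this]
    exact Finset.single_le_sum (f := fun i => Polynomial.eval x (q i) ^ 2)
      (fun i _ => sq_nonneg _) (Finset.mem_univ i)
  have h3 : |Polynomial.eval x (q i)| ≤ max c 1 := by
    by_contra hc
    push Not at hc
    have h4 := le_max_left c 1
    have h5 := le_max_right c 1
    rw [← sq_abs] at h2
    nlinarith
  exact h3

lemma sos_hom {n : ℕ} {g : RR} (hg : g.IsHomogeneous 6) (h : Fin n → RR)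
    (e : g = ∑ i, h i ^ 2) (i : Fin n) : (h i).IsHomogeneous 3 := by
  apply hom_of_comp
  intro k hk
  apply MvPolynomial.funext
  intro u
  rw [map_zero, ← gr_coeff]
  have e1 : ∑ i, ((gr (h i)).map (eval u)) ^ 2 = Polynomial.C (eval u g) * Polynomial.X ^ (4 + 2) := by
    have := congrArg (fun p => (gr p).map (eval u)) e
    simp only [map_sum, map_pow, Polynomial.map_pow, Polynomial.map_sum] at this
    rw [← this, gr_hom hg, Polynomial.map_monomial, Polynomial.C_mul_X_pow_eq_monomial]
  obtain ⟨r, hr, e2⟩ := sq_step _ _ e1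
  obtain ⟨r2, hr2, e3⟩ := sq_step (m := 2) _ _ e2
  obtain ⟨r3, hr3, e4⟩ := sq_step (m := 0) _ _ e3
  obtain ⟨b, hb⟩ := sq_const r3 _ (by simpa using e4) i
  have : (gr (h i)).map (eval u) = Polynomial.C b * Polynomial.X ^ 3 := by
    rw [hr, hr2, hr3, hb]; ring
  have h5 := congrArg (fun p => Polynomial.coeff p k) this
  simpa [Polynomial.coeff_map, Polynomial.coeff_C_mul, Polynomial.coeff_X_pow, hk] using h5

end

section

/-- cross product -/
abbrev cr (a b : V3) : V3 := crossProduct a b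

/-- general position of eight vectors -/
structure GP (p : Fin 8 → V3) : Prop where
  np : ∀ i j, i ≠ j → cr (p i) (p j) ≠ 0
  linep : ∀ l : RR, l ≠ 0 → l.IsHomogeneous 1 → ∀ s : Finset (Fin 8),
    (∀ i ∈ s, eval (p i) l = 0) → s.card ≤ 3
  conic : ∀ c : RR, c ≠ 0 → c.IsHomogeneous 2 → ∀ s : Finset (Fin 8),
    (∀ i ∈ s, eval (p i) c = 0) → s.card ≤ 6

lemma GP.line {p : Fin 8 → V3} (hp : GP p) (a : V3) (ha : a ≠ 0) (s : Finset (Fin 8))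
    (h : ∀ i ∈ s, a ⬝ᵥ p i = 0) : s.card ≤ 3 :=
  hp.linep (LL a) (LL_ne ha) (LL_hom a) s (by simpa using h)

lemma dot3 (a b : V3) : a ⬝ᵥ b = a 0 * b 0 + a 1 * b 1 + a 2 * b 2 := by
  simp [dotProduct, Fin.sum_univ_three]

lemma cr0 (a b : V3) : cr a b 0 = a 1 * b 2 - a 2 * b 1 := by simp [cr, cross_apply]
lemma cr1 (a b : V3) : cr a b 1 = a 2 * b 0 - a 0 * b 2 := by simp [cr, cross_apply]
lemma cr2 (a b : V3) : cr a b 2 = a 0 * b 1 - a 1 * b 0 := by simp [cr, cross_apply]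

lemma cr_l (a b : V3) : cr a b ⬝ᵥ a = 0 := by simp only [dot3, cr0, cr1, cr2]; ring
lemma cr_r (a b : V3) : cr a b ⬝ᵥ b = 0 := by simp only [dot3, cr0, cr1, cr2]; ring

lemma dot_self_pos {a : V3} (h : a ≠ 0) : 0 < a ⬝ᵥ a := by
  rcases (show 0 ≤ a ⬝ᵥ a by rw [dot3]; nlinarith [sq_nonneg (a 0), sq_nonneg (a 1), sq_nonneg (a 2)]).lt_or_eq with h1 | h1
  · exact h1
  · exact absurd (dotProduct_self_eq_zero.1 h1.symm) h

variable {p : Fin 8 → V3}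

lemma GP.ne (hp : GP p) (i : Fin 8) : p i ≠ 0 := by
  obtain ⟨j, hj⟩ := exists_ne i
  intro h
  apply hp.np i j hj.symm
  simp [cr, h]

/-- the line through two points -/
abbrev LN (p : Fin 8 → V3) (x y : Fin 8) : RR := LL (cr (p x) (p y))

lemma GP.noTwo (hp : GP p) {x y z k : Fin 8} (hxy : x ≠ y) (hxz : x ≠ z) (hyz : y ≠ z)
    (hx : x ≠ k) (hy : y ≠ k) (hz : z ≠ k) (h1 : cr (p x) (p y) ⬝ᵥ p k = 0) :
    cr (p x) (p z) ⬝ᵥ p k ≠ 0 := by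
  intro h2
  have := hp.line (cr (p x) (p k)) (hp.np _ _ hx) {x, y, z, k} (by
    intro i hi
    simp only [Finset.mem_insert, Finset.mem_singleton] at hi
    rcases hi with rfl | rfl | rfl | rfl
    · exact cr_l _ _
    · simp only [dot3, cr0, cr1, cr2] at *; linarith
    · simp only [dot3, cr0, cr1, cr2] at *; linarith
    · exact cr_r _ _)
  rw [Finset.card_eq_of_equiv_fin (n := 4)] at this
  · omega
  · apply Finset.equivFinOfCardEq
    rw [Finset.card_insert_of_notMem, Finset.card_insert_of_notMem, Finset.card_insert_of_notMem]
    · simp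
    all_goals simp [*]

lemma GP.five (hp : GP p) {s : Finset (Fin 8)} (hs : s.card = 5) {k : Fin 8} (hk : k ∈ s) :
    ∃ g : RR, g.IsHomogeneous 2 ∧ eval (p k) g ≠ 0 ∧ ∀ j ∈ s, j ≠ k → eval (p j) g = 0 := by
  have h4 : (s.erase k).card = 4 := by rw [Finset.card_erase_of_mem hk, hs]
  obtain ⟨a, t, hat, e, ht⟩ := Finset.card_eq_succ.1 h4
  obtain ⟨b, c, d, hbc, hbd, hcd, rfl⟩ := Finset.card_eq_three.1 ht
  have hne : ∀ j ∈ s.erase k, j ≠ k := fun j hj => Finset.ne_of_mem_erase hj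
  rw [← e] at hne
  simp only [Finset.mem_insert, Finset.mem_singleton, forall_eq_or_imp, forall_eq] at hne
  obtain ⟨ha, hb, hc, hd⟩ := hne
  simp only [Finset.mem_insert, Finset.mem_singleton, not_or] at hat
  obtain ⟨hab, hac, had⟩ := hat
  change a ≠ b at hab
  change a ≠ c at hac
  change a ≠ d at had
  have key : ∀ x y z w : Fin 8, ({x, y, z, w} : Finset (Fin 8)) = s.erase k → 
      cr (p x) (p y) ⬝ᵥ p k ≠ 0 → cr (p z) (p w) ⬝ᵥ p k ≠ 0 → 
      ∃ g : RR, g.IsHomogeneous 2 ∧ eval (p k) g ≠ 0 ∧ ∀ j ∈ s, j ≠ k → eval (p j) g = 0 := by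
    intro x y z w e h1 h2
    refine ⟨LN p x y * LN p z w, (LL_hom _).mul (LL_hom _), ?_, ?_⟩
    · simp only [map_mul, eval_LL]
      exact mul_ne_zero h1 h2
    · intro j hj hjk
      have : j ∈ s.erase k := Finset.mem_erase.2 ⟨hjk, hj⟩
      rw [← e] at this
      simp only [Finset.mem_insert, Finset.mem_singleton] at this
      simp only [map_mul, eval_LL]
      rcases this with rfl | rfl | rfl | rfl
      · rw [cr_l, zero_mul]
      · rw [cr_r, zero_mul]
      · rw [cr_l, mul_zero]
      · rw [cr_r, mul_zero]
  have sw : ∀ x y : Fin 8, cr (p x) (p y) ⬝ᵥ p k = 0 → cr (p y) (p x) ⬝ᵥ p k = 0 := by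
    intro x y h
    simp only [dot3, cr0, cr1, cr2] at *; linarith
  have e2 : ({a, c, b, d} : Finset (Fin 8)) = s.erase k := by
    rw [← e]; ext; simp; tauto
  by_cases h1 : cr (p a) (p b) ⬝ᵥ p k = 0
  · apply key a c b d e2
    · exact hp.noTwo hab hac hbc ha hb hc h1
    · exact hp.noTwo hab.symm hbd had hb ha hd (sw _ _ h1)
  · by_cases h2 : cr (p c) (p d) ⬝ᵥ p k = 0
    · apply key a c b d e2
      · intro h
        exact hp.noTwo hcd hac.symm had.symm hc hd ha h2 (sw _ _ h)
      · intro h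
        exact hp.noTwo hcd.symm hbd.symm hbc.symm hd hc hb (sw _ _ h2) (sw _ _ h)
    · exact key a b c d e h1 h2

lemma GP.five_unique (hp : GP p) {s : Finset (Fin 8)} (hs : s.card = 5) {c c' : RR}
    (hc : c.IsHomogeneous 2) (hc' : c'.IsHomogeneous 2) (h : ∀ i ∈ s, eval (p i) c = 0)
    (h' : ∀ i ∈ s, eval (p i) c' = 0) (h0 : c' ≠ 0) : ∃ t : ℝ, c = t • c' := by
  have h1 := JJ_eq 2 (fun i : s => p i) (by
    rintro ⟨i, hi⟩
    obtain ⟨g, h1, h2, h3⟩ := hp.five hs hi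
    exact ⟨g, h1, h2, fun j hj => h3 j j.2 (fun h => hj (Subtype.ext h))⟩)
  rw [finrank_HH, Fintype.card_coe, hs] at h1
  have h2 : Module.finrank ℝ (JJ 2 (fun i : s => p i)) = 1 := by
    have : (2 + 2).choose 2 = 6 := by decide
    omega
  have m : c ∈ JJ 2 (fun i : s => p i) := mem_JJ.2 ⟨hc, fun i => h i i.2⟩
  have m' : c' ∈ JJ 2 (fun i : s => p i) := mem_JJ.2 ⟨hc', fun i => h' i i.2⟩
  obtain ⟨t, ht⟩ := (finrank_eq_one_iff_of_nonzero' (⟨c', m'⟩ : JJ 2 (fun i : s => p i))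
    (fun h => h0 (congrArg Subtype.val h))).1 h2 ⟨c, m⟩
  exact ⟨t, (congrArg Subtype.val ht).symm⟩

lemma exists_conic (p : Fin 8 → V3) {s : Finset (Fin 8)} (hs : s.card = 5) :
    ∃ c : RR, c ≠ 0 ∧ c.IsHomogeneous 2 ∧ ∀ i ∈ s, eval (p i) c = 0 := by
  have h1 := JJ_ge 2 (fun i : s => p i)
  rw [finrank_HH, Fintype.card_coe, hs] at h1
  have h2 : 0 < Module.finrank ℝ (JJ 2 (fun i : s => p i)) := by
    have : (2 + 2).choose 2 = 6 := by decide
    omega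
  have := Module.finrank_pos_iff.1 h2
  obtain ⟨⟨c, hc⟩, h0⟩ := exists_ne (0 : JJ 2 (fun i : s => p i))
  obtain ⟨h3, h4⟩ := mem_JJ.1 hc
  exact ⟨c, fun h => h0 (Subtype.ext h), h3, fun i hi => h4 ⟨i, hi⟩⟩

lemma GP.cubic (hp : GP p) (i : Fin 8) :
    ∃ g : RR, g.IsHomogeneous 3 ∧ eval (p i) g = 1 ∧ ∀ j, j ≠ i → eval (p j) g = 0 := by
  suffices h : ∃ g : RR, g.IsHomogeneous 3 ∧ eval (p i) g ≠ 0 ∧ ∀ j, j ≠ i → eval (p j) g = 0 by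
    obtain ⟨g, h1, h2, h3⟩ := h
    refine ⟨C (eval (p i) g)⁻¹ * g, h1.C_mul _, by simp [h2], fun j hj => by simp [h3 j hj]⟩
  obtain ⟨j, hj⟩ := exists_ne i
  let B := (Finset.univ.filter fun k => k ≠ i ∧ k ≠ j ∧ cr (p j) (p k) ⬝ᵥ p i ≠ 0)
  have hB : 2 ≤ B.card := by
    have h1 := hp.line (cr (p i) (p j)) (hp.np _ _ hj.symm) 
      (Finset.univ.filter fun k => cr (p i) (p j) ⬝ᵥ p k = 0) (by simp)
    have h2 : Finset.univ ⊆ B ∪ (Finset.univ.filter fun k => cr (p i) (p j) ⬝ᵥ p k = 0) := by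
      intro k _
      simp only [B, Finset.mem_union, Finset.mem_filter, Finset.mem_univ, true_and]
      by_cases h : cr (p i) (p j) ⬝ᵥ p k = 0
      · right; exact h
      · left
        refine ⟨?_, ?_, ?_⟩
        · rintro rfl; exact h (cr_l _ _)
        · rintro rfl; exact h (cr_r _ _)
        · intro h3; apply h; simp only [dot3, cr0, cr1, cr2] at *; linarith
    have h3 := (Finset.card_le_card h2).trans (Finset.card_union_le _ _)
    simp at h3
    omega
  obtain ⟨k, hk, l, hl, hkl⟩ := Finset.one_lt_card.1 hB
  simp only [B, Finset.mem_filter, Finset.mem_univ, true_and] at hk hl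
  obtain ⟨hki, hkj, hk⟩ := hk
  obtain ⟨hli, hlj, hl⟩ := hl
  let R : Finset (Fin 8) := {i, j, k, l}ᶜ
  have hR : R.card = 4 := by
    rw [Finset.card_compl, Finset.card_insert_of_notMem, Finset.card_insert_of_notMem,
      Finset.card_insert_of_notMem]
    · simp
    all_goals simp [*, Ne.symm]
  have hiR : i ∉ R := by simp [R]
  have hjR : j ∉ R := by simp [R]
  have hkR : k ∉ R := by simp [R]
  have hlR : l ∉ R := by simp [R]
  have hcov : ∀ x, x ≠ i → x = j ∨ x = k ∨ x = l ∨ x ∈ R := by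
    intro x hx
    simp only [R, Finset.mem_compl, Finset.mem_insert, Finset.mem_singleton]
    tauto
  obtain ⟨c, c0, ch, cv⟩ := exists_conic p (s := insert l R) (by
    rw [Finset.card_insert_of_notMem hlR, hR])
  obtain ⟨c', c0', ch', cv'⟩ := exists_conic p (s := insert k R) (by
    rw [Finset.card_insert_of_notMem hkR, hR])
  simp only [Finset.mem_insert, forall_eq_or_imp] at cv cv'
  by_cases h1 : eval (p i) c = 0
  · by_cases h2 : eval (p i) c' = 0
    · exfalso
      obtain ⟨t, ht⟩ := hp.five_unique (s := insert i R) (by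
        rw [Finset.card_insert_of_notMem hiR, hR]) ch ch' (by
          simp only [Finset.mem_insert, forall_eq_or_imp]; exact ⟨h1, cv.2⟩) (by
          simp only [Finset.mem_insert, forall_eq_or_imp]; exact ⟨h2, cv'.2⟩) c0'
      have := hp.conic c c0 ch (insert i (insert k (insert l R))) (by
        simp only [Finset.mem_insert, forall_eq_or_imp]
        refine ⟨h1, ?_, cv⟩
        rw [ht, smul_eval, cv'.1, mul_zero])
      rw [Finset.card_insert_of_notMem, Finset.card_insert_of_notMem,
        Finset.card_insert_of_notMem hlR, hR] at this
      · omega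
      · simp [hkl, hkR]
      · simp [hki.symm, hli.symm, hiR]
    · refine ⟨c' * LN p j l, ch'.mul (LL_hom _), ?_, ?_⟩
      · rw [map_mul, eval_LL]; exact mul_ne_zero h2 hl
      · intro x hx
        rw [map_mul, eval_LL]
        rcases hcov x hx with rfl | rfl | rfl | hx
        · rw [cr_l, mul_zero]
        · rw [cv'.1, zero_mul]
        · rw [cr_r, mul_zero]
        · rw [cv'.2 _ hx, zero_mul]
  · refine ⟨c * LN p j k, ch.mul (LL_hom _), ?_, ?_⟩
    · rw [map_mul, eval_LL]; exact mul_ne_zero h1 hk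
    · intro x hx
      rw [map_mul, eval_LL]
      rcases hcov x hx with rfl | rfl | rfl | hx
      · rw [cr_l, mul_zero]
      · rw [cr_r, mul_zero]
      · rw [cv.1, zero_mul]
      · rw [cv.2 _ hx, zero_mul]

end

section

variable {p : Fin 8 → V3}

/-- a linear form through r separating from q -/
abbrev sep (r q : V3) : V3 := cr r (cr r q)
lemma sep_l (r q : V3) : sep r q ⬝ᵥ r = 0 := cr_l _ _
lemma sep_r {r q : V3} (h : cr r q ≠ 0) : sep r q ⬝ᵥ q ≠ 0 := by
  have h1 := dot_self_pos h
  have : sep r q ⬝ᵥ q = - (cr r q ⬝ᵥ cr r q) := by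
    simp only [dot3, cr0, cr1, cr2]; ring
  rw [this]; linarith

lemma cr_symm_ne {r q : V3} (h : cr r q ≠ 0) : cr q r ≠ 0 := by
  intro h2; apply h
  rw [← neg_eq_zero, cr, cross_anticomm]; exact h2

lemma const_of_hom {f : RR} (h : f.IsHomogeneous 0) : ∃ c, f = C c := by
  refine ⟨coeff 0 f, ?_⟩
  rw [← totalDegree_eq_zero_iff_eq_C]
  exact (totalDegree_zero_iff_isHomogeneous _).2 h

lemma line_unique {q r : V3} (h : cr q r ≠ 0) {l l' : RR} (hl : l.IsHomogeneous 1)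
    (hl' : l'.IsHomogeneous 1) (h0 : l' ≠ 0) (h1 : eval q l = 0) (h2 : eval r l = 0)
    (h3 : eval q l' = 0) (h4 : eval r l' = 0) : ∃ t : ℝ, l = t • l' := by
  have e := JJ_eq 1 ![q, r] (by
    intro i
    fin_cases i
    · refine ⟨LL (sep r q), LL_hom _, ?_, ?_⟩
      · simpa using sep_r (cr_symm_ne h)
      · intro j hj; fin_cases j
        · simp at hj
        · simpa using sep_l r q
    · refine ⟨LL (sep q r), LL_hom _, ?_, ?_⟩
      · simpa using sep_r h
      · intro j hj; fin_cases j
        · simpa using sep_l q r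
        · simp at hj)
  rw [finrank_HH] at e
  have e2 : Module.finrank ℝ (JJ 1 ![q, r]) = 1 := by
    have : (1 + 2).choose 2 = 3 := by decide
    simp at e
    omega
  have m : l ∈ JJ 1 ![q, r] := mem_JJ.2 ⟨hl, fun i => by fin_cases i <;> assumption⟩
  have m' : l' ∈ JJ 1 ![q, r] := mem_JJ.2 ⟨hl', fun i => by fin_cases i <;> assumption⟩
  obtain ⟨t, ht⟩ := (finrank_eq_one_iff_of_nonzero' (⟨l', m'⟩ : JJ 1 ![q, r])
    (fun h => h0 (congrArg Subtype.val h))).1 e2 ⟨l, m⟩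
  exact ⟨t, (congrArg Subtype.val ht).symm⟩

/-- a basis of the pencil of cubics through eight points -/
structure Pencil (p : Fin 8 → V3) (f₁ f₂ : RR) : Prop where
  m1 : f₁ ∈ JJ 3 p
  m2 : f₂ ∈ JJ 3 p
  spn : ∀ f ∈ JJ 3 p, ∃ α β : ℝ, f = α • f₁ + β • f₂
  ind : ∀ α β : ℝ, α • f₁ + β • f₂ = 0 → α = 0 ∧ β = 0

lemma GP.finrank3 (hp : GP p) : Module.finrank ℝ (JJ 3 p) = 2 := by
  have e := JJ_eq 3 p (fun i => by
    obtain ⟨g, h1, h2, h3⟩ := hp.cubic i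
    exact ⟨g, h1, by rw [h2]; exact one_ne_zero, h3⟩)
  rw [finrank_HH] at e
  have : (3 + 2).choose 2 = 10 := by decide
  rw [this, Fintype.card_fin] at e
  omega

lemma GP.exists_pencil (hp : GP p) : ∃ f₁ f₂, Pencil p f₁ f₂ := by
  let b := Module.finBasisOfFinrankEq ℝ (JJ 3 p) hp.finrank3
  refine ⟨b 0, b 1, (b 0).2, (b 1).2, ?_, ?_⟩
  · intro f hf
    have := b.sum_repr ⟨f, hf⟩
    rw [Fin.sum_univ_two] at this
    exact ⟨_, _, (congrArg Subtype.val this).symm⟩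
  · intro α β h
    have h2 := Fintype.linearIndependent_iff.1 b.linearIndependent ![α, β] (by
      rw [Fin.sum_univ_two]; exact Subtype.ext h)
    exact ⟨h2 0, h2 1⟩

variable {f₁ f₂ : RR}

lemma Pencil.ne1 (h : Pencil p f₁ f₂) : f₁ ≠ 0 := by
  rintro rfl
  have := h.ind 1 0 (by simp)
  simp at this
lemma Pencil.ne2 (h : Pencil p f₁ f₂) : f₂ ≠ 0 := by
  rintro rfl
  have := h.ind 0 1 (by simp)
  simp at this
lemma Pencil.h1 (h : Pencil p f₁ f₂) : f₁.IsHomogeneous 3 := (mem_JJ.1 h.m1).1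
lemma Pencil.h2 (h : Pencil p f₁ f₂) : f₂.IsHomogeneous 3 := (mem_JJ.1 h.m2).1
lemma Pencil.v1 (h : Pencil p f₁ f₂) (i : Fin 8) : eval (p i) f₁ = 0 := (mem_JJ.1 h.m1).2 i
lemma Pencil.v2 (h : Pencil p f₁ f₂) (i : Fin 8) : eval (p i) f₂ = 0 := (mem_JJ.1 h.m2).2 i

lemma Pencil.np (h : Pencil p f₁ f₂) (t : ℝ) : f₁ ≠ t • f₂ := by
  intro e
  have := h.ind 1 (-t) (by rw [e]; simp)
  simp at this

lemma Pencil.coprime (hp : GP p) (h : Pencil p f₁ f₂) : IsRelPrime f₁ f₂ := by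
  rintro d ⟨g₁, e₁⟩ ⟨g₂, e₂⟩
  obtain ⟨k, l, hkl, dk, gl⟩ := factor_hom (f := d) (g := g₁) (n := 3) (e₁ ▸ h.ne1) (e₁ ▸ h.h1)
  obtain ⟨k', l', hkl', dk', gl'⟩ := factor_hom (f := d) (g := g₂) (n := 3) (e₂ ▸ h.ne2) (e₂ ▸ h.h2)
  have d0 : d ≠ 0 := by rintro rfl; exact h.ne1 (by rw [e₁, zero_mul])
  have g0 : g₂ ≠ 0 := by rintro rfl; exact h.ne2 (by rw [e₂, mul_zero])
  have := dk.inj_right dk' d0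
  subst this
  have : l' = l := by omega
  subst this
  have key : ∀ t : ℝ, g₁ ≠ t • g₂ := by
    intro t ht
    apply h.np t
    rw [e₁, e₂, ht, mul_smul_comm]
  have z1 : ∀ i, eval (p i) d ≠ 0 → eval (p i) g₁ = 0 := by
    intro i hi
    have := h.v1 i
    rw [e₁, map_mul] at this
    exact (mul_eq_zero.1 this).resolve_left hi
  have z2 : ∀ i, eval (p i) d ≠ 0 → eval (p i) g₂ = 0 := by
    intro i hi
    have := h.v2 i
    rw [e₂, map_mul] at this
    exact (mul_eq_zero.1 this).resolve_left hi
  let Z := Finset.univ.filter fun i => eval (p i) d = 0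
  have hZ : ∀ i ∈ Zᶜ, eval (p i) d ≠ 0 := by
    intro i hi; simpa [Z] using hi
  have hZc : Zᶜ.card + Z.card = 8 := by
    rw [add_comm, Finset.card_add_card_compl]; simp
  have : k = 0 ∨ k = 1 ∨ k = 2 ∨ k = 3 := by omega
  rcases this with rfl | rfl | rfl | rfl
  · obtain ⟨c, rfl⟩ := const_of_hom dk
    have : c ≠ 0 := by rintro rfl; simp at d0
    exact (isUnit_iff_ne_zero.2 this).map C
  · exfalso
    have := hp.linep d d0 dk Z (by simp [Z])
    obtain ⟨s, hs, hs5⟩ := Finset.exists_subset_card_eq (s := Zᶜ) (n := 5) (by omega)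
    have l2 : l' = 2 := by omega
    subst l2
    obtain ⟨t, ht⟩ := hp.five_unique hs5 gl gl' (fun i hi => z1 i (hZ i (hs hi)))
      (fun i hi => z2 i (hZ i (hs hi))) g0
    exact key t ht
  · exfalso
    have := hp.conic d d0 dk Z (by simp [Z])
    obtain ⟨x, hx, y, hy, hxy⟩ := Finset.one_lt_card.1 (show 1 < Zᶜ.card by omega)
    have l1 : l' = 1 := by omega
    subst l1
    obtain ⟨t, ht⟩ := line_unique (hp.np x y hxy) gl gl' g0 (z1 x (hZ x hx)) (z1 y (hZ y hy))
      (z2 x (hZ x hx)) (z2 y (hZ y hy))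
    exact key t ht
  · exfalso
    have l0 : l' = 0 := by omega
    subst l0
    obtain ⟨c, rfl⟩ := const_of_hom gl
    obtain ⟨c', rfl⟩ := const_of_hom gl'
    have : c' ≠ 0 := by rintro rfl; simp at g0
    apply key (c / c')
    rw [smul_eq_C_mul, ← C_mul, div_mul_cancel₀ _ this]

lemma Pencil.rel (hp : GP p) (h : Pencil p f₁ f₂) {a b : RR} (ha : a.IsHomogeneous 3)
    (e : a * f₁ + b * f₂ = 0) : ∃ c : ℝ, a = c • f₂ ∧ b = -c • f₁ := by
  have hd : f₂ ∣ a * f₁ := ⟨-b, by linear_combination e⟩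
  obtain ⟨c, rfl⟩ := (h.coprime hp).symm.dvd_of_dvd_mul_right hd
  have e2 : b = - c * f₁ := by
    apply mul_right_cancel₀ h.ne2
    linear_combination e
  by_cases h0 : f₂ * c = 0
  · have : c = 0 := (mul_eq_zero.1 h0).resolve_left h.ne2
    subst this
    exact ⟨0, by simp, by simp [e2]⟩
  · obtain ⟨k, l, hkl, hk, hl⟩ := factor_hom h0 ha
    have := hk.inj_right h.h2 h.ne2
    have : l = 0 := by omega
    subst this
    obtain ⟨c, rfl⟩ := const_of_hom hl
    refine ⟨c, by rw [smul_eq_C_mul, mul_comm], by rw [e2, smul_eq_C_mul]; simp⟩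

end

section

variable {p : Fin 8 → V3} {f₁ f₂ : RR}

/-- multiplication map -/
def mulMap (f₁ f₂ : RR) : (HH 3 × HH 3) →ₗ[ℝ] RR :=
  (((LinearMap.mulRight ℝ f₁).domRestrict (HH 3)).coprod ((LinearMap.mulRight ℝ f₂).domRestrict (HH 3)))

/-- the degree-six part of the ideal (f₁, f₂) -/
def I6 (f₁ f₂ : RR) : Submodule ℝ RR := LinearMap.range (mulMap f₁ f₂)

lemma mem_I6 {g : RR} : g ∈ I6 f₁ f₂ ↔
    ∃ a b : RR, a.IsHomogeneous 3 ∧ b.IsHomogeneous 3 ∧ g = a * f₁ + b * f₂ := by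
  constructor
  · rintro ⟨⟨⟨a, ha⟩, ⟨b, hb⟩⟩, rfl⟩
    exact ⟨a, b, ha, hb, rfl⟩
  · rintro ⟨a, b, ha, hb, rfl⟩
    exact ⟨⟨⟨a, ha⟩, ⟨b, hb⟩⟩, rfl⟩

lemma I6_le (h : Pencil p f₁ f₂) : I6 f₁ f₂ ≤ JJ 6 p := by
  intro g hg
  obtain ⟨a, b, ha, hb, rfl⟩ := mem_I6.1 hg
  refine mem_JJ.2 ⟨(ha.mul h.h1).add (hb.mul h.h2), fun i => ?_⟩
  simp [h.v1 i, h.v2 i]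

lemma I6_finrank (hp : GP p) (h : Pencil p f₁ f₂) : 19 ≤ Module.finrank ℝ (I6 f₁ f₂) := by
  have e := (mulMap f₁ f₂).finrank_range_add_finrank_ker
  have h1 : Module.finrank ℝ (LinearMap.ker (mulMap f₁ f₂)) ≤ 1 := by
    have : LinearMap.ker (mulMap f₁ f₂) ≤
        Submodule.span ℝ {((⟨f₂, h.h2⟩, -⟨f₁, h.h1⟩) : HH 3 × HH 3)} := by
      rintro ⟨⟨a, ha⟩, ⟨b, hb⟩⟩ hab
      have e : a * f₁ + b * f₂ = 0 := hab
      obtain ⟨c, rfl, rfl⟩ := h.rel hp ha e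
      rw [Submodule.mem_span_singleton]
      refine ⟨c, ?_⟩
      apply Prod.ext
      · rfl
      · apply Subtype.ext
        simp
    exact (Submodule.finrank_mono this).trans ((finrank_span_le_card _).trans (by simp))
  rw [Module.finrank_prod, finrank_HH] at e
  have : (3 + 2).choose 2 = 10 := by decide
  unfold I6
  omega

lemma GP.finrank6 (hp : GP p) : Module.finrank ℝ (JJ 6 p) = 20 := by
  have e := JJ_eq 6 p (fun i => by
    obtain ⟨g, h1, h2, h3⟩ := hp.cubic i
    refine ⟨g * LL (p i) ^ 3, h1.mul ((LL_hom _).pow 3), ?_, fun j hj => by simp [h3 j hj]⟩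
    simp [h2, (dot_self_pos (hp.ne i)).ne'])
  rw [finrank_HH] at e
  have : (6 + 2).choose 2 = 28 := by decide
  rw [this, Fintype.card_fin] at e
  omega

lemma I6_eq (hp : GP p) (h : Pencil p f₁ f₂) (L : RR →ₗ[ℝ] ℝ) (hL : ∀ g ∈ I6 f₁ f₂, L g = 0)
    {g' : RR} (hg' : g' ∈ JJ 6 p) (hn : L g' ≠ 0) {g : RR} (hg : g ∈ JJ 6 p) (h0 : L g = 0) :
    g ∈ I6 f₁ f₂ := by
  have h1 : I6 f₁ f₂ ≤ JJ 6 p ⊓ LinearMap.ker L := le_inf (I6_le h) (fun g hg => hL g hg)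
  have h2 : JJ 6 p ⊓ LinearMap.ker L < JJ 6 p := by
    refine lt_of_le_of_ne inf_le_left (fun e => hn ?_)
    rw [← e] at hg'
    exact hg'.2
  have h3 := Submodule.finrank_lt_finrank_of_lt h2
  rw [hp.finrank6] at h3
  have : Module.Finite ℝ ↥(JJ 6 p ⊓ LinearMap.ker L) := Submodule.finiteDimensional_of_le h2.le
  have h4 := Submodule.eq_of_le_of_finrank_le h1 (by have := I6_finrank hp h; omega)
  rw [h4]
  exact ⟨hg, h0⟩

/-- sextics singular at all points -/
def WW (p : Fin 8 → V3) : Submodule ℝ RR :=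
  HH 6 ⊓ LinearMap.ker (LinearMap.pi fun i => LinearMap.pi fun j : Fin 3 =>
    (evL (p i)).comp (pderiv j : Derivation ℝ RR RR).toLinearMap)

lemma mem_WW' {g : RR} : g ∈ WW p ↔ g.IsHomogeneous 6 ∧ ∀ i j, eval (p i) (pderiv j g) = 0 := by
  simp [WW, LinearMap.mem_ker, funext_iff, mem_homogeneousSubmodule]

lemma mem_WW {g : RR} : g ∈ WW p ↔ g.IsHomogeneous 6 ∧ ∀ i v, eval (p i) (DD v g) = 0 := by
  rw [mem_WW']
  refine and_congr_right fun _ => forall_congr' fun i => ⟨fun h v => ?_, fun h j => ?_⟩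
  · rw [eval_DD]; simp [h]
  · have := h (Pi.single j 1)
    rw [eval_DD] at this
    simpa [Pi.single_apply] using this

instance : Module.Finite ℝ (WW p) :=
  Submodule.finiteDimensional_of_le (inf_le_left : WW p ≤ HH 6)

lemma WW_le : WW p ≤ JJ 6 p := by
  intro g hg
  obtain ⟨h1, h2⟩ := mem_WW.1 hg
  refine mem_JJ.2 ⟨h1, fun i => ?_⟩
  have := euler h1 (p i)
  rw [h2] at this
  norm_num at this
  exact this

lemma WW_ge : 4 ≤ Module.finrank ℝ (WW p) := by
  have := ker_ge 6 (LinearMap.pi fun i : Fin 8 => LinearMap.pi fun j : Fin 3 =>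
    (evL (p i)).comp (pderiv j : Derivation ℝ RR RR).toLinearMap)
  rw [finrank_HH, Module.finrank_pi_fintype] at this
  have h2 : (6 + 2).choose 2 = 28 := by decide
  rw [h2] at this
  simp at this
  unfold WW
  omega

/-- span of products of cubics -/
def W0 (p : Fin 8 → V3) : Submodule ℝ RR :=
  Submodule.span ℝ {h | ∃ f₁ ∈ JJ 3 p, ∃ f₂ ∈ JJ 3 p, h = f₁ * f₂}

lemma W0_mul {a b : RR} (ha : a ∈ JJ 3 p) (hb : b ∈ JJ 3 p) : a * b ∈ W0 p :=
  Submodule.subset_span ⟨a, ha, b, hb, rfl⟩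

lemma W0_eq (h : Pencil p f₁ f₂) :
    W0 p = Submodule.span ℝ (Set.range ![f₁ * f₁, f₁ * f₂, f₂ * f₂]) := by
  apply le_antisymm
  · apply Submodule.span_le.2
    rintro g ⟨a, ha, b, hb, rfl⟩
    obtain ⟨α, β, rfl⟩ := h.spn a ha
    obtain ⟨γ, δ, rfl⟩ := h.spn b hb
    have : (α • f₁ + β • f₂) * (γ • f₁ + δ • f₂) = (α * γ) • (f₁ * f₁) +
        (α * δ + β * γ) • (f₁ * f₂) + (β * δ) • (f₂ * f₂) := by
      simp only [smul_eq_C_mul, C_mul, C_add]; ring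
    rw [this]
    refine Submodule.add_mem _ (Submodule.add_mem _ ?_ ?_) ?_ <;> apply Submodule.smul_mem <;>
      apply Submodule.subset_span
    · exact ⟨0, rfl⟩
    · exact ⟨1, rfl⟩
    · exact ⟨2, rfl⟩
  · apply Submodule.span_le.2
    rintro g ⟨i, rfl⟩
    fin_cases i
    · exact W0_mul h.m1 h.m1
    · exact W0_mul h.m1 h.m2
    · exact W0_mul h.m2 h.m2

lemma W0_finrank (hp : GP p) (h : Pencil p f₁ f₂) : Module.finrank ℝ (W0 p) = 3 := by
  rw [W0_eq h, finrank_span_eq_card]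
  · simp
  · rw [Fintype.linearIndependent_iff]
    intro g hg
    rw [Fin.sum_univ_three] at hg
    simp only [Matrix.cons_val] at hg
    have e : (g 0 • f₁ + g 1 • f₂) * f₁ + (g 2 • f₂) * f₂ = 0 := by
      rw [← hg]
      simp only [smul_eq_C_mul]; ring
    obtain ⟨c, h1, h2⟩ := h.rel hp ((HH 3).add_mem ((HH 3).smul_mem _ h.h1) ((HH 3).smul_mem _ h.h2)) e
    have a1 := h.ind (g 0) (g 1 - c) (by rw [sub_smul, ← h1]; abel)
    have a2 := h.ind c (g 2) (by rw [h2]; simp)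
    intro i
    fin_cases i
    · exact a1.1
    · have := a1.2; have := a2.1; simp; linarith
    · exact a2.2

instance W0_fin : Module.Finite ℝ (W0 p) := by
  apply Submodule.finiteDimensional_of_le (S₂ := HH 6)
  apply Submodule.span_le.2
  rintro g ⟨a, ha, b, hb, rfl⟩
  exact (mem_JJ.1 ha).1.mul (mem_JJ.1 hb).1

lemma eval_DD_mul (v u : V3) (a b : RR) :
    eval u (DD v (a * b)) = eval u a * eval u (DD v b) + eval u b * eval u (DD v a) := by
  simp [Derivation.leibniz]

lemma W0_le : W0 p ≤ WW p := by
  apply Submodule.span_le.2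
  rintro g ⟨a, ha, b, hb, rfl⟩
  rw [mem_JJ] at ha hb
  refine mem_WW.2 ⟨ha.1.mul hb.1, fun i v => ?_⟩
  rw [eval_DD_mul, ha.2, hb.2]; ring

/-- non-transversality -/
def NT (f₁ f₂ : RR) (q : V3) : Prop :=
  ∃ v, cr q v ≠ 0 ∧ eval q (DD v f₁) = 0 ∧ eval q (DD v f₂) = 0

/-- gradient -/
def gd (q : V3) (f : RR) : V3 := fun i => eval q (pderiv i f)

lemma eval_DD' (v q : V3) (f : RR) : eval q (DD v f) = gd q f ⬝ᵥ v := by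
  rw [eval_DD, dotProduct]; simp [gd, mul_comm]

lemma exists_cr_ne {q : V3} (hq : q ≠ 0) : ∃ v, cr q v ≠ 0 := by
  by_contra! h
  apply hq
  have h1 := h (Pi.single 0 1)
  have h2 := h (Pi.single 1 1)
  have e1 := congrFun h1 1
  have e2 := congrFun h1 2
  have e3 := congrFun h2 2
  rw [cr1] at e1
  rw [cr2] at e2 e3
  simp at e1 e2 e3
  ext i; fin_cases i
  · exact e3
  · exact e2
  · exact e1

lemma nt_of_cr {a b q : V3} (hq : q ≠ 0) (ha : a ⬝ᵥ q = 0) (hb : b ⬝ᵥ q = 0) (hab : cr a b = 0) :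
    ∃ v, cr q v ≠ 0 ∧ a ⬝ᵥ v = 0 ∧ b ⬝ᵥ v = 0 := by
  have key : ∀ a : V3, a ⬝ᵥ q = 0 → a ≠ 0 → cr q (cr q a) ≠ 0 := by
    intro a ha h0 h
    have h1 := dot_self_pos h0
    have h2 := dot_self_pos hq
    have h3 : cr q (cr q a) ⬝ᵥ a = 0 := by rw [h]; simp
    have h4 : cr q (cr q a) ⬝ᵥ a = (a ⬝ᵥ q) ^ 2 - (q ⬝ᵥ q) * (a ⬝ᵥ a) := by
      simp only [dot3, cr0, cr1, cr2]; ring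
    rw [h4, ha] at h3
    have := mul_pos h2 h1
    linarith
  have t : ∀ a b : V3, cr a b = 0 → b ⬝ᵥ cr q a = 0 := by
    intro a b h
    have : b ⬝ᵥ cr q a = q ⬝ᵥ cr a b := by simp only [dot3, cr0, cr1, cr2]; ring
    rw [this, h]; simp
  by_cases h1 : a = 0
  · by_cases h2 : b = 0
    · obtain ⟨v, hv⟩ := exists_cr_ne hq
      exact ⟨v, hv, by simp [h1], by simp [h2]⟩
    · exact ⟨cr q b, key b hb h2, by simp [h1], t b b (by simp [cr])⟩
  · exact ⟨cr q a, key a ha h1, t a a (by simp [cr]), t a b hab⟩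

lemma not_nt {q : V3} (hq : q ≠ 0) {n : ℕ} (h1 : f₁.IsHomogeneous n) (h2 : f₂.IsHomogeneous n) 
    (v1 : eval q f₁ = 0) (v2 : eval q f₂ = 0) (h : ¬ NT f₁ f₂ q) {α β : ℝ}
    (e : ∀ v, α * eval q (DD v f₁) + β * eval q (DD v f₂) = 0) : α = 0 ∧ β = 0 := by
  by_contra hc
  apply h
  have a1 : gd q f₁ ⬝ᵥ q = 0 := by rw [← eval_DD', euler h1, v1, mul_zero]
  have a2 : gd q f₂ ⬝ᵥ q = 0 := by rw [← eval_DD', euler h2, v2, mul_zero]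
  have e' : ∀ i, α * gd q f₁ i + β * gd q f₂ i = 0 := by
    intro i
    have := e (Pi.single i 1)
    simpa [eval_DD'] using this
  obtain ⟨v, hv, b1, b2⟩ := nt_of_cr hq a1 a2 (by
    have e0 := e' 0
    have e1 := e' 1
    have e2 := e' 2
    have : α ≠ 0 ∨ β ≠ 0 := by tauto
    rcases this with h | h
    · ext i
      apply mul_left_cancel₀ h
      fin_cases i
      · simp only [Fin.zero_eta, cr0]; rw [Pi.zero_apply, mul_zero]; linear_combination gd q f₂ 2 * e1 - gd q f₂ 1 * e2
      · simp only [Fin.mk_one, cr1]; rw [Pi.zero_apply, mul_zero]; linear_combination gd q f₂ 0 * e2 - gd q f₂ 2 * e0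
      · simp only [Fin.reduceFinMk, cr2]; rw [Pi.zero_apply, mul_zero]; linear_combination gd q f₂ 1 * e0 - gd q f₂ 0 * e1
    · ext i
      apply mul_left_cancel₀ h
      fin_cases i
      · simp only [Fin.zero_eta, cr0]; rw [Pi.zero_apply, mul_zero]; linear_combination gd q f₁ 1 * e2 - gd q f₁ 2 * e1
      · simp only [Fin.mk_one, cr1]; rw [Pi.zero_apply, mul_zero]; linear_combination gd q f₁ 2 * e0 - gd q f₁ 0 * e2
      · simp only [Fin.reduceFinMk, cr2]; rw [Pi.zero_apply, mul_zero]; linear_combination gd q f₁ 0 * e1 - gd q f₁ 1 * e0)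
  exact ⟨v, hv, by rw [eval_DD', b1], by rw [eval_DD', b2]⟩

lemma WI_le (hp : GP p) (h : Pencil p f₁ f₂) (ht : ∀ i, ¬ NT f₁ f₂ (p i)) :
    WW p ⊓ I6 f₁ f₂ ≤ W0 p := by
  rintro g ⟨hg, hg2⟩
  obtain ⟨a, b, ha, hb, rfl⟩ := mem_I6.1 hg2
  have hv : ∀ i, eval (p i) a = 0 ∧ eval (p i) b = 0 := by
    intro i
    apply not_nt (hp.ne i) h.h1 h.h2 (h.v1 i) (h.v2 i) (ht i)
    intro v
    have := (mem_WW.1 hg).2 i v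
    rw [map_add, map_add, eval_DD_mul, eval_DD_mul, h.v1, h.v2] at this
    linarith
  exact Submodule.add_mem _ (W0_mul (mem_JJ.2 ⟨ha, fun i => (hv i).1⟩) h.m1)
    (W0_mul (mem_JJ.2 ⟨hb, fun i => (hv i).2⟩) h.m2)

lemma WW_finrank_A (hp : GP p) (h : Pencil p f₁ f₂) (ht : ∀ i, ¬ NT f₁ f₂ (p i)) :
    Module.finrank ℝ (WW p) ≤ 4 := by
  have : Module.Finite ℝ (I6 f₁ f₂) := Submodule.finiteDimensional_of_le (I6_le h)
  have e := Submodule.finrank_sup_add_finrank_inf_eq (WW p) (I6 f₁ f₂)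
  have h1 := Submodule.finrank_mono (WI_le hp h ht)
  have h2 := Submodule.finrank_mono (sup_le WW_le (I6_le h))
  rw [W0_finrank hp h] at h1
  rw [hp.finrank6] at h2
  have := I6_finrank hp h
  omega

end

section

open Filter Topology

lemma expand (g : RR) (q v w : V3) : ∃ A B D : ℝ × ℝ → ℝ, Continuous A ∧ Continuous B ∧ Continuous D ∧
    A 0 = 1 / 2 * eval q (DD v (DD v g)) ∧ ∀ z : ℝ × ℝ, eval (q + z.1 • v + z.2 • w) g =
      eval q g + z.1 * eval q (DD v g) + z.2 * eval q (DD w g) + z.1 ^ 2 * A z + z.1 * z.2 * B z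
        + z.2 ^ 2 * D z := by
  induction g using MvPolynomial.induction_on with
  | C a =>
    refine ⟨fun _ => 0, fun _ => 0, fun _ => 0, continuous_const, continuous_const, continuous_const,
      ?_, fun z => ?_⟩ <;> simp [← algebraMap_eq, Derivation.map_algebraMap]
  | add f g hf hg =>
    obtain ⟨A, B, D, hA, hB, hD, h0, h⟩ := hf
    obtain ⟨A', B', D', hA', hB', hD', h0', h'⟩ := hg
    refine ⟨fun z => A z + A' z, fun z => B z + B' z, fun z => D z + D' z, hA.add hA', hB.add hB',
      hD.add hD', ?_, fun z => ?_⟩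
    · simp only [map_add, h0, h0']; ring
    · simp only [map_add, h, h']; ring
  | mul_X g i hg =>
    obtain ⟨A, B, D, hA, hB, hD, h0, h⟩ := hg
    refine ⟨fun z => A z * (q i + z.1 * v i + z.2 * w i) + eval q (DD v g) * v i,
      fun z => B z * (q i + z.1 * v i + z.2 * w i) + eval q (DD v g) * w i + eval q (DD w g) * v i,
      fun z => D z * (q i + z.1 * v i + z.2 * w i) + eval q (DD w g) * w i, by fun_prop, by fun_prop,
      by fun_prop, ?_, fun z => ?_⟩
    · simp only [Derivation.leibniz, DD_X, h0, map_add, smul_eq_mul, map_mul, eval_X, eval_C,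
        Prod.fst_zero, Prod.snd_zero, ← algebraMap_eq, Derivation.map_algebraMap]
      simp only [algebraMap_eq, eval_C, map_zero]
      ring
    · simp only [Derivation.leibniz, DD_X, map_add, smul_eq_mul, map_mul, eval_X, eval_C, h,
        Pi.add_apply, Pi.smul_apply]
      ring

lemma expand1 (g : RR) (q v w : V3) (h0 : eval q g = 0) : ∃ α β : ℝ × ℝ → ℝ, Continuous α ∧ Continuous β ∧
    α 0 = eval q (DD v g) ∧ β 0 = eval q (DD w g) ∧
    ∀ z : ℝ × ℝ, eval (q + z.1 • v + z.2 • w) g = z.1 * α z + z.2 * β z := by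
  obtain ⟨A, B, D, hA, hB, hD, -, h⟩ := expand g q v w
  refine ⟨fun z => eval q (DD v g) + z.1 * A z + z.2 * B z, fun z => eval q (DD w g) + z.2 * D z,
    by fun_prop, by fun_prop, by simp, by simp, fun z => ?_⟩
  rw [h, h0]; ring

lemma ineq_a {x y a b a' b' A B D d0 S0 K0 : ℝ} (hd : 0 < d0) (hK : 0 ≤ K0)
    (h1 : d0 / 2 < (a * b' - a' * b) ^ 2) (h2 : a ^ 2 + b ^ 2 + a' ^ 2 + b' ^ 2 < S0 + 1)
    (h3 : |A| + |B| + |D| < K0 + 1) :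
    0 ≤ (K0 + 1) * ((S0 + 1) / (d0 / 2)) * ((x * a + y * b) ^ 2 + (x * a' + y * b') ^ 2) +
      (x ^ 2 * A + x * y * B + y ^ 2 * D) := by
  have k1 : (a * b' - a' * b) ^ 2 * (x ^ 2 + y ^ 2) ≤
      (a ^ 2 + b ^ 2 + a' ^ 2 + b' ^ 2) * ((x * a + y * b) ^ 2 + (x * a' + y * b') ^ 2) := by
    have : (a ^ 2 + b ^ 2 + a' ^ 2 + b' ^ 2) * ((x * a + y * b) ^ 2 + (x * a' + y * b') ^ 2) -
      (a * b' - a' * b) ^ 2 * (x ^ 2 + y ^ 2) = (b' * (x * a' + y * b') + b * (x * a + y * b)) ^ 2 +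
        (a * (x * a + y * b) + a' * (x * a' + y * b')) ^ 2 := by ring
    have : 0 ≤ (b' * (x * a' + y * b') + b * (x * a + y * b)) ^ 2 +
        (a * (x * a + y * b) + a' * (x * a' + y * b')) ^ 2 := by positivity
    linarith
  generalize x * a + y * b = F1 at *
  generalize x * a' + y * b' = F2 at *
  have k2 : x ^ 2 + y ^ 2 ≤ ((S0 + 1) / (d0 / 2)) * (F1 ^ 2 + F2 ^ 2) := by
    rw [div_mul_eq_mul_div, le_div_iff₀ (by positivity)]
    have := mul_le_mul_of_nonneg_right h2.le (by positivity : 0 ≤ F1 ^ 2 + F2 ^ 2)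
    have := mul_le_mul_of_nonneg_right h1.le (by positivity : 0 ≤ x ^ 2 + y ^ 2)
    linarith
  have k3 : -((|A| + |B| + |D|) * (x ^ 2 + y ^ 2)) ≤ x ^ 2 * A + x * y * B + y ^ 2 * D := by
    have i1 : x ^ 2 * -A ≤ x ^ 2 * |A| := mul_le_mul_of_nonneg_left (neg_le_abs _) (sq_nonneg _)
    have i2 : y ^ 2 * -D ≤ y ^ 2 * |D| := mul_le_mul_of_nonneg_left (neg_le_abs _) (sq_nonneg _)
    have i3 : -(x * y * B) ≤ |x * y| * |B| := by rw [← abs_mul]; exact neg_le_abs _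
    have i4 : |x * y| * |B| ≤ (x ^ 2 + y ^ 2) * |B| := by
      apply mul_le_mul_of_nonneg_right _ (abs_nonneg _)
      rw [abs_le]
      constructor <;> nlinarith [sq_nonneg (x + y), sq_nonneg (x - y)]
    have i5 : 0 ≤ x ^ 2 * |D| := by positivity
    have i6 : 0 ≤ y ^ 2 * |A| := by positivity
    linarith
  have k4 := mul_le_mul_of_nonneg_right h3.le (by positivity : 0 ≤ x ^ 2 + y ^ 2)
  have k5 := mul_le_mul_of_nonneg_left k2 (by positivity : 0 ≤ K0 + 1)
  rw [← mul_assoc] at k5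
  linarith

lemma ineq_b {x y α β A B D A0 B0 D0 t K F2 : ℝ} (hA : 0 < A0) (ht : 0 < t) (hK : 0 < K)
    (K_def : K = (B0 + 1) ^ 2 / A0 + D0 + 1)
    (h1 : 3 / 4 * A0 < A) (h2 : |B| < B0 + 1) (h3 : |D| < D0 + 1) (h4 : t < β ^ 2)
    (h5 : α ^ 2 < A0 * t / (4 * K)) :
    0 ≤ 2 * K / t * ((x * α + y * β) ^ 2 + F2 ^ 2) + (x ^ 2 * A + x * y * B + y ^ 2 * D) := by
  have k1 : x ^ 2 * (A0 / 2) - K * y ^ 2 ≤ x ^ 2 * A + x * y * B + y ^ 2 * D := by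
    have i1 : x ^ 2 * (3 / 4 * A0) ≤ x ^ 2 * A := mul_le_mul_of_nonneg_left h1.le (sq_nonneg _)
    have i2 : y ^ 2 * -D ≤ y ^ 2 * (D0 + 1) :=
      mul_le_mul_of_nonneg_left ((neg_le_abs _).trans h3.le) (sq_nonneg _)
    have i3 : -(x * y * B) ≤ |x * y| * (B0 + 1) := by
      refine (neg_le_abs _).trans ?_
      rw [abs_mul]
      exact mul_le_mul_of_nonneg_left h2.le (abs_nonneg _)
    have i4 : |x * y| * (B0 + 1) ≤ x ^ 2 * (A0 / 4) + (B0 + 1) ^ 2 / A0 * y ^ 2 := by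
      rw [abs_mul, ← sq_abs x, ← sq_abs y]
      have : |x| ^ 2 * (A0 / 4) + (B0 + 1) ^ 2 / A0 * |y| ^ 2 - |x| * |y| * (B0 + 1) =
        (|x| * A0 / 2 - (B0 + 1) * |y|) ^ 2 / A0 := by field_simp; ring
      have : 0 ≤ (|x| * A0 / 2 - (B0 + 1) * |y|) ^ 2 / A0 := by positivity
      linarith
    rw [K_def]
    linarith
  have k2 : y ^ 2 * t ≤ 2 * (x * α + y * β) ^ 2 + 2 * (x ^ 2 * (A0 * t / (4 * K))) := by
    have i1 : y ^ 2 * t ≤ y ^ 2 * β ^ 2 := mul_le_mul_of_nonneg_left h4.le (sq_nonneg _)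
    have i2 : x ^ 2 * α ^ 2 ≤ x ^ 2 * (A0 * t / (4 * K)) :=
      mul_le_mul_of_nonneg_left h5.le (sq_nonneg _)
    nlinarith [sq_nonneg (x * α + y * β + x * α)]
  generalize x * α + y * β = F1 at *
  have k3 : K * y ^ 2 ≤ 2 * K / t * F1 ^ 2 + x ^ 2 * (A0 / 2) := by
    have := mul_le_mul_of_nonneg_left k2 (by positivity : 0 ≤ K / t)
    have j1 : K / t * (y ^ 2 * t) = K * y ^ 2 := by field_simp
    have j2 : K / t * (2 * F1 ^ 2 + 2 * (x ^ 2 * (A0 * t / (4 * K)))) =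
      2 * K / t * F1 ^ 2 + x ^ 2 * (A0 / 2) := by field_simp; ring
    linarith
  have k4 : 0 ≤ 2 * K / t * F2 ^ 2 := by positivity
  linarith

lemma loc_a {f₁ f₂ h : RR} {q v w : V3} (e1 : eval q f₁ = 0) (e2 : eval q f₂ = 0)
    (e3 : eval q h = 0) (e4 : ∀ v, eval q (DD v h) = 0)
    (hd : eval q (DD v f₁) * eval q (DD w f₂) - eval q (DD v f₂) * eval q (DD w f₁) ≠ 0) :
    ∃ M : ℝ, ∀ᶠ z : ℝ × ℝ in 𝓝 0, 0 ≤ M * (eval (q + z.1 • v + z.2 • w) f₁ ^ 2 +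
      eval (q + z.1 • v + z.2 • w) f₂ ^ 2) + eval (q + z.1 • v + z.2 • w) h := by
  obtain ⟨a, b, ha, hb, a0, b0, H1⟩ := expand1 f₁ q v w e1
  obtain ⟨a', b', ha', hb', a0', b0', H2⟩ := expand1 f₂ q v w e2
  obtain ⟨A, B, D, hA, hB, hD, -, H⟩ := expand h q v w
  rw [← a0, ← b0, ← a0', ← b0'] at hd
  let d : ℝ × ℝ → ℝ := fun z => (a z * b' z - a' z * b z) ^ 2
  let S : ℝ × ℝ → ℝ := fun z => a z ^ 2 + b z ^ 2 + a' z ^ 2 + b' z ^ 2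
  let K : ℝ × ℝ → ℝ := fun z => |A z| + |B z| + |D z|
  have cd : Continuous d := by fun_prop
  have cS : Continuous S := by fun_prop
  have cK : Continuous K := by fun_prop
  have d0 : 0 < d 0 := by positivity
  have S0 : 0 ≤ S 0 := by positivity
  have K0 : 0 ≤ K 0 := by positivity
  have E1 := cd.continuousAt.eventually_mem (Ioi_mem_nhds (half_lt_self d0))
  have E2 := cS.continuousAt.eventually_mem (Iio_mem_nhds (lt_add_one (S 0)))
  have E3 := cK.continuousAt.eventually_mem (Iio_mem_nhds (lt_add_one (K 0)))
  refine ⟨(K 0 + 1) * ((S 0 + 1) / (d 0 / 2)), ?_⟩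
  filter_upwards [E1, E2, E3] with z h1 h2 h3
  simp only [Set.mem_Ioi, Set.mem_Iio] at h1 h2 h3
  rw [H, H1, H2, e3, e4, e4]
  have := ineq_a (x := z.1) (y := z.2) d0 K0 h1 h2 h3
  simp only [mul_zero, add_zero, zero_add]
  exact this

lemma loc_b {f₁ f₂ h : RR} {q v w : V3} (e1 : eval q f₁ = 0)
    (e3 : eval q h = 0) (e4 : ∀ v, eval q (DD v h) = 0) (e5 : 0 < eval q (DD v (DD v h)))
    (hv : eval q (DD v f₁) = 0) (hw : eval q (DD w f₁) ≠ 0) :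
    ∃ M : ℝ, ∀ᶠ z : ℝ × ℝ in 𝓝 0, 0 ≤ M * (eval (q + z.1 • v + z.2 • w) f₁ ^ 2 +
      eval (q + z.1 • v + z.2 • w) f₂ ^ 2) + eval (q + z.1 • v + z.2 • w) h := by
  obtain ⟨α, β, ha, hb, a0, b0, H1⟩ := expand1 f₁ q v w e1
  obtain ⟨A, B, D, hA, hB, hD, hA0, H⟩ := expand h q v w
  have A0 : 0 < A 0 := by rw [hA0]; linarith
  rw [hv] at a0
  rw [← b0] at hw
  let t := β 0 ^ 2 / 2
  have t0 : 0 < t := by positivity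
  let K := (|B 0| + 1) ^ 2 / A 0 + |D 0| + 1
  have K0 : 0 < K := by positivity
  have E1 := hA.continuousAt.eventually_mem (Ioi_mem_nhds (by linarith : 3 / 4 * A 0 < A 0))
  have E2 := hB.abs.continuousAt.eventually_mem (Iio_mem_nhds (lt_add_one |B 0|))
  have E3 := hD.abs.continuousAt.eventually_mem (Iio_mem_nhds (lt_add_one |D 0|))
  have E4 := (hb.pow 2).continuousAt.eventually_mem
    (Ioi_mem_nhds (half_lt_self (by positivity) : t < β 0 ^ 2))
  have E5 := (ha.pow 2).continuousAt.eventually_mem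
    (Iio_mem_nhds (by rw [a0, zero_pow two_ne_zero]; positivity : α 0 ^ 2 < A 0 * t / (4 * K)))
  refine ⟨2 * K / t, ?_⟩
  filter_upwards [E1, E2, E3, E4, E5] with z h1 h2 h3 h4 h5
  simp only [Set.mem_Ioi, Set.mem_Iio] at h1 h2 h3 h4 h5
  rw [H, H1, e3, e4, e4]
  have := ineq_b (x := z.1) (y := z.2) (F2 := eval (q + z.1 • v + z.2 • w) f₂) A0 t0 K0 rfl h1 h2 h3 h4 h5
  simp only [mul_zero, add_zero, zero_add]
  exact this

lemma loc_lift {φ : RR} (hφ : φ.IsHomogeneous 6) {q v : V3} (hv : cr q v ≠ 0)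
    (h : ∀ᶠ z : ℝ × ℝ in 𝓝 0, 0 ≤ eval (q + z.1 • v + z.2 • cr q v) φ) :
    ∀ᶠ u in 𝓝 q, 0 ≤ eval u φ := by
  set w := cr q v with hw
  have N := dot_self_pos hv
  let s : V3 → ℝ := fun u => u ⬝ᵥ cr v w / (w ⬝ᵥ w)
  let x : V3 → ℝ := fun u => u ⬝ᵥ cr w q / (w ⬝ᵥ w)
  let y : V3 → ℝ := fun u => u ⬝ᵥ w / (w ⬝ᵥ w)
  have cs : Continuous s := by simp only [s, dot3]; fun_prop
  have cx : Continuous x := by simp only [x, dot3]; fun_prop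
  have cy : Continuous y := by simp only [y, dot3]; fun_prop
  have s0 : s q = 1 := by
    simp only [s]
    rw [div_eq_one_iff_eq N.ne', hw]
    simp only [dot3, cr0, cr1, cr2]; ring
  have x0 : x q = 0 := by
    simp only [x]
    rw [div_eq_zero_iff]; left
    simp only [dot3, cr0, cr1, cr2]; ring
  have y0 : y q = 0 := by
    simp only [y]
    rw [div_eq_zero_iff]; left
    simp only [hw, dot3, cr0, cr1, cr2]; ring
  have dec : ∀ u, u = s u • q + x u • v + y u • w := by
    intro u
    have : (w ⬝ᵥ w) • u = (w ⬝ᵥ w) • (s u • q + x u • v + y u • w) := by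
      simp only [smul_add, smul_smul, s, x, y, mul_div_cancel₀ _ N.ne']
      ext i
      simp only [Pi.smul_apply, Pi.add_apply, smul_eq_mul]
      fin_cases i <;> simp only [Fin.zero_eta, Fin.mk_one, Fin.reduceFinMk, hw, dot3, cr0, cr1, cr2] <;> ring
    exact smul_right_injective _ N.ne' this
  have E1 := cs.continuousAt.eventually_ne (by rw [s0]; exact one_ne_zero : s q ≠ 0)
  have T : Tendsto (fun u => (x u / s u, y u / s u)) (𝓝 q) (𝓝 (0 : ℝ × ℝ)) := by
    have h1 : ContinuousAt (fun u => (x u / s u, y u / s u)) q :=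
      (cx.continuousAt.div cs.continuousAt (by simp [s0])).prodMk
        (cy.continuousAt.div cs.continuousAt (by simp [s0]))
    have := h1.tendsto
    rw [x0, y0, zero_div] at this
    exact this
  filter_upwards [E1, T.eventually h] with u h1 h2
  have : u = s u • (q + (x u / s u) • v + (y u / s u) • w) := by
    conv_lhs => rw [dec u]
    simp only [smul_add, smul_smul, mul_div_cancel₀ _ h1]
  rw [this, eval_smul_hom hφ]
  exact mul_nonneg (by positivity) h2

/-- local boundedness property -/
def LocB (f₁ f₂ h : RR) (q : V3) : Prop :=
  ∃ M : ℝ, ∀ᶠ u in 𝓝 q, 0 ≤ M * (eval u f₁ ^ 2 + eval u f₂ ^ 2) + eval u h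

lemma locB_lift {f₁ f₂ h : RR} (h1 : f₁.IsHomogeneous 3) (h2 : f₂.IsHomogeneous 3)
    (h3 : h.IsHomogeneous 6) {q v : V3} (hv : cr q v ≠ 0)
    (H : ∃ M : ℝ, ∀ᶠ z : ℝ × ℝ in 𝓝 0, 0 ≤ M * (eval (q + z.1 • v + z.2 • cr q v) f₁ ^ 2 +
      eval (q + z.1 • v + z.2 • cr q v) f₂ ^ 2) + eval (q + z.1 • v + z.2 • cr q v) h) :
    LocB f₁ f₂ h q := by
  obtain ⟨M, hM⟩ := H
  refine ⟨M, ?_⟩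
  have := loc_lift (φ := C M * (f₁ ^ 2 + f₂ ^ 2) + h)
    ((((h1.pow 2).add (h2.pow 2)).C_mul M).add h3) hv (by simpa using hM)
  simpa using this

lemma locB_smul {f₁ f₂ h : RR} (h1 : f₁.IsHomogeneous 3) (h2 : f₂.IsHomogeneous 3)
    (h3 : h.IsHomogeneous 6) {q : V3} {c : ℝ} (hc : c ≠ 0) (H : LocB f₁ f₂ h q) :
    LocB f₁ f₂ h (c • q) := by
  obtain ⟨M, hM⟩ := H
  refine ⟨M, ?_⟩
  have T : Tendsto (fun u : V3 => c⁻¹ • u) (𝓝 (c • q)) (𝓝 q) := by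
    have : ContinuousAt (fun u : V3 => c⁻¹ • u) (c • q) := by fun_prop
    have := this.tendsto
    rwa [inv_smul_smul₀ hc] at this
  filter_upwards [T.eventually hM] with u hu
  rw [eval_smul_hom h1, eval_smul_hom h2, eval_smul_hom h3] at hu
  have : M * (eval u f₁ ^ 2 + eval u f₂ ^ 2) + eval u h = c ^ 6 *
      (M * ((c⁻¹ ^ 3 * eval u f₁) ^ 2 + (c⁻¹ ^ 3 * eval u f₂) ^ 2) + c⁻¹ ^ 6 * eval u h) := by
    field_simp
  rw [this]
  exact mul_nonneg (by positivity) hu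

lemma ev_cont (f : RR) : Continuous (fun u : V3 => eval u f) := MvPolynomial.continuous_eval f

lemma locB_pos {f₁ f₂ h : RR} {q : V3} (H : 0 < eval q h) : LocB f₁ f₂ h q := by
  refine ⟨0, ?_⟩
  filter_upwards [(ev_cont h).continuousAt.eventually_mem (Ioi_mem_nhds H)] with u hu
  simp only [Set.mem_Ioi] at hu
  linarith

lemma locB_ne {f₁ f₂ h : RR} {q : V3} (H : ¬ (eval q f₁ = 0 ∧ eval q f₂ = 0)) : LocB f₁ f₂ h q := by
  have hpos : 0 < eval q (f₁ ^ 2 + f₂ ^ 2) := by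
    simp only [map_add, map_pow]
    by_contra hc
    apply H
    constructor <;> nlinarith [sq_nonneg (eval q f₁), sq_nonneg (eval q f₂)]
  set m := eval q (f₁ ^ 2 + f₂ ^ 2)
  refine ⟨(|eval q h| + 1) / (m / 2), ?_⟩
  filter_upwards [(ev_cont (f₁ ^ 2 + f₂ ^ 2)).continuousAt.eventually_mem (Ioi_mem_nhds (half_lt_self hpos)),
    (ev_cont h).abs.continuousAt.eventually_mem (Iio_mem_nhds (lt_add_one _))] with u h1 h2
  simp only [Set.mem_Ioi, Set.mem_Iio] at h1 h2
  have := mul_le_mul_of_nonneg_left h1.le (by positivity : 0 ≤ (|eval q h| + 1) / (m / 2))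
  rw [div_mul_cancel₀ _ (by positivity)] at this
  rw [map_add, map_pow, map_pow] at this
  have := neg_abs_le (eval u h)
  linarith

lemma psd_of_locB {f₁ f₂ h : RR} (h1 : f₁.IsHomogeneous 3) (h2 : f₂.IsHomogeneous 3)
    (h3 : h.IsHomogeneous 6) (H : ∀ q : V3, q ≠ 0 → LocB f₁ f₂ h q) :
    ∃ M : ℝ, Psd (C M * (f₁ ^ 2 + f₂ ^ 2) + h) := by
  have key : ∃ M : ℝ, ∀ u ∈ Metric.sphere (0 : V3) 1,
      0 ≤ M * (eval u f₁ ^ 2 + eval u f₂ ^ 2) + eval u h := by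
    apply (isCompact_sphere (0 : V3) 1).induction_on
      (p := fun s => ∃ M : ℝ, ∀ u ∈ s, 0 ≤ M * (eval u f₁ ^ 2 + eval u f₂ ^ 2) + eval u h)
    · exact ⟨0, by simp⟩
    · rintro s t hst ⟨M, hM⟩
      exact ⟨M, fun u hu => hM u (hst hu)⟩
    · rintro s t ⟨M, hM⟩ ⟨M', hM'⟩
      refine ⟨max M M', ?_⟩
      rintro u (hu | hu)
      · have := mul_le_mul_of_nonneg_right (le_max_left M M')
          (by positivity : 0 ≤ eval u f₁ ^ 2 + eval u f₂ ^ 2)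
        linarith [hM u hu]
      · have := mul_le_mul_of_nonneg_right (le_max_right M M')
          (by positivity : 0 ≤ eval u f₁ ^ 2 + eval u f₂ ^ 2)
        linarith [hM' u hu]
    · intro q hq
      obtain ⟨M, hM⟩ := H q (by rintro rfl; simp at hq)
      exact ⟨_, mem_nhdsWithin_of_mem_nhds hM, M, fun u hu => hu⟩
  obtain ⟨M, hM⟩ := key
  refine ⟨M, fun u => ?_⟩
  have hh : (C M * (f₁ ^ 2 + f₂ ^ 2) + h).IsHomogeneous 6 :=
    (((h1.pow 2).add (h2.pow 2)).C_mul M).add h3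
  by_cases hu : u = 0
  · subst hu
    have := eval_smul_hom hh 0 0
    rw [zero_smul] at this
    rw [this]; simp
  · have hn : ‖u‖ ≠ 0 := norm_ne_zero_iff.2 hu
    have := hM (‖u‖⁻¹ • u) (by simp [norm_smul, hn])
    have e : u = ‖u‖ • (‖u‖⁻¹ • u) := by rw [smul_inv_smul₀ hn]
    rw [e, eval_smul_hom hh]
    refine mul_nonneg (by positivity) ?_
    simpa using this

end

section

open Filter Topology
variable {p : Fin 8 → V3} {f₁ f₂ : RR}

lemma decomp {q v : V3} (hv : cr q v ≠ 0) (u : V3) :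
    ∃ s x y : ℝ, u = s • q + x • v + y • cr q v := by
  have N := dot_self_pos hv
  set w := cr q v with hw
  refine ⟨u ⬝ᵥ cr v w / (w ⬝ᵥ w), u ⬝ᵥ cr w q / (w ⬝ᵥ w), u ⬝ᵥ w / (w ⬝ᵥ w), ?_⟩
  apply smul_right_injective _ N.ne'
  simp only [smul_add, smul_smul, mul_div_cancel₀ _ N.ne']
  ext i
  simp only [Pi.smul_apply, Pi.add_apply, smul_eq_mul]
  fin_cases i <;> simp only [Fin.zero_eta, Fin.mk_one, Fin.reduceFinMk, hw, dot3, cr0, cr1, cr2] <;> ring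

lemma smul_of_cr {q z : V3} (hq : q ≠ 0) (hz : z ≠ 0) (h : cr q z = 0) : ∃ c : ℝ, c ≠ 0 ∧ z = c • q := by
  have N := dot_self_pos hq
  have e0 := congrFun h 0
  have e1 := congrFun h 1
  have e2 := congrFun h 2
  rw [cr0, Pi.zero_apply] at e0
  rw [cr1, Pi.zero_apply] at e1
  rw [cr2, Pi.zero_apply] at e2
  have e : z = ((q ⬝ᵥ z) / (q ⬝ᵥ q)) • q := by
    apply smul_right_injective _ N.ne'
    simp only [smul_smul, mul_div_cancel₀ _ N.ne']
    ext i
    simp only [Pi.smul_apply, smul_eq_mul]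
    fin_cases i <;> simp only [Fin.zero_eta, Fin.mk_one, Fin.reduceFinMk, dot3]
    · linear_combination q 2 * e1 - q 1 * e2
    · linear_combination q 0 * e2 - q 2 * e0
    · linear_combination q 1 * e0 - q 0 * e1
  refine ⟨_, ?_, e⟩
  intro h0
  rw [h0, zero_smul] at e
  exact hz e

lemma exists_e_ne (hp : GP p) (h : Pencil p f₁ f₂) {z : V3} (hz : z ≠ 0) (z1 : eval z f₁ = 0)
    (z2 : eval z f₂ = 0) : ∃ i, ∃ e : RR, e.IsHomogeneous 3 ∧ eval (p i) e = 1 ∧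
      (∀ j, j ≠ i → eval (p j) e = 0) ∧ eval z e ≠ 0 := by
  choose e h1 h2 h3 using hp.cubic
  by_contra! hc
  have hz0 : ∀ i, eval z (e i) = 0 := fun i => hc i (e i) (h1 i) (h2 i) (h3 i)
  let k : RR := LL z ^ 3 - ∑ i, C (eval (p i) (LL z ^ 3)) * e i
  have hk : k ∈ JJ 3 p := by
    refine mem_JJ.2 ⟨?_, fun j => ?_⟩
    · apply (HH 3).sub_mem
      · exact (LL_hom z).pow 3
      · exact (HH 3).sum_mem fun i _ => (h1 i).C_mul _
    · simp only [k, map_sub, map_sum, map_mul, eval_C]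
      rw [Finset.sum_eq_single j]
      · rw [h2]; ring
      · intro i _ hij
        rw [h3 i j (Ne.symm hij), mul_zero]
      · simp
  obtain ⟨α, β, hab⟩ := h.spn k hk
  have e1 : eval z k = 0 := by rw [hab]; simp [smul_eq_C_mul, z1, z2]
  simp only [k, map_sub, map_sum, map_mul, hz0, mul_zero, Finset.sum_const_zero, sub_zero, map_pow,
    eval_LL] at e1
  exact (dot_self_pos hz).ne' (pow_eq_zero_iff (by norm_num) |>.1 e1)

lemma ev_I6 {z : V3} (z1 : eval z f₁ = 0) (z2 : eval z f₂ = 0) {g : RR} (hg : g ∈ I6 f₁ f₂) :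
    eval z g = 0 := by
  obtain ⟨a, b, -, -, rfl⟩ := mem_I6.1 hg
  simp [z1, z2]

lemma D_I6 {z v : V3} (z1 : eval z f₁ = 0) (z2 : eval z f₂ = 0) (d1 : eval z (DD v f₁) = 0)
    (d2 : eval z (DD v f₂) = 0) {g : RR} (hg : g ∈ I6 f₁ f₂) :
    eval z (DD v g) = 0 := by
  obtain ⟨a, b, -, -, rfl⟩ := mem_I6.1 hg
  rw [map_add, map_add, eval_DD_mul, eval_DD_mul, z1, z2, d1, d2]; ring

lemma locB_transv (h : Pencil p f₁ f₂) {i : Fin 8} (hi : p i ≠ 0) (ht : ¬ NT f₁ f₂ (p i)) {g : RR}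
    (hg : g ∈ WW p) : LocB f₁ f₂ g (p i) := by
  obtain ⟨v, hv⟩ := exists_cr_ne hi
  apply locB_lift h.h1 h.h2 (mem_WW.1 hg).1 hv
  apply loc_a (h.v1 i) (h.v2 i) ((mem_JJ.1 (WW_le hg)).2 i) ((mem_WW.1 hg).2 i)
  intro hd
  have key := not_nt hi h.h1 h.h2 (h.v1 i) (h.v2 i) ht (α := eval (p i) (DD v f₂))
    (β := - eval (p i) (DD v f₁)) (fun u => by
      obtain ⟨s, x, y, rfl⟩ := decomp hv u
      have E1 := euler h.h1 (p i)
      have E2 := euler h.h2 (p i)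
      rw [h.v1, mul_zero] at E1
      rw [h.v2, mul_zero] at E2
      simp only [eval_DD', dotProduct_add, dotProduct_smul, smul_eq_mul] at *
      rw [E1, E2]
      linear_combination -y * hd)
  exact ht ⟨v, hv, by linarith [key.2], key.1⟩

/-- final positivity from local data -/
lemma psd_final (hp : GP p) (h : Pencil p f₁ f₂) {g : RR} (hg : g ∈ WW p)
    (hl : ∀ i, LocB f₁ f₂ g (p i))
    (hz : ∀ z : V3, eval z f₁ = 0 → eval z f₂ = 0 → (∀ i, cr (p i) z ≠ 0) → 0 < eval z g) :
    ∃ M : ℝ, Psd (C M * (f₁ ^ 2 + f₂ ^ 2) + g) := by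
  have h6 := (mem_WW.1 hg).1
  apply psd_of_locB h.h1 h.h2 h6
  intro q hq
  by_cases hb : eval q f₁ = 0 ∧ eval q f₂ = 0
  · by_cases hc : ∀ i, cr (p i) q ≠ 0
    · exact locB_pos (hz q hb.1 hb.2 hc)
    · push Not at hc
      obtain ⟨i, hi⟩ := hc
      obtain ⟨c, hc, rfl⟩ := smul_of_cr (hp.ne i) hq hi
      exact locB_smul h.h1 h.h2 h6 hc (hl i)
  · exact locB_ne hb

/-- the conclusion of the case analysis -/
def Concl (p : Fin 8 → V3) : Prop :=
  Module.finrank ℝ (WW p) ≤ 4 ∧ ∃ f₁ ∈ JJ 3 p, ∃ f₂ ∈ JJ 3 p, ∃ g ∈ WW p, g ∉ W0 p ∧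
    ∃ M : ℝ, Psd (C M * (f₁ ^ 2 + f₂ ^ 2) + g)

lemma ne_of_cr {a b : V3} (h : cr a b ≠ 0) : b ≠ 0 := by
  rintro rfl
  apply h
  simp [cr]

lemma zero_of_hom {g : RR} (hg : g ∈ JJ 6 p) : eval 0 g = 0 := by
  have := eval_smul_hom (mem_JJ.1 hg).1 0 0
  rw [zero_smul] at this
  rw [this]; simp

lemma extra_I6 (hp : GP p) (h : Pencil p f₁ f₂) {z : V3} (z1 : eval z f₁ = 0)
    (z2 : eval z f₂ = 0) (hc : ∀ i, cr (p i) z ≠ 0) {g : RR} (hg : g ∈ JJ 6 p) (h0 : eval z g = 0) :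
    g ∈ I6 f₁ f₂ := by
  obtain ⟨i, e, h1, h2, h3, h4⟩ := exists_e_ne hp h (ne_of_cr (hc 0)) z1 z2
  apply I6_eq hp h (evL z) (fun g hg => by rw [evL_apply]; exact ev_I6 z1 z2 hg)
    (g' := e * LL (sep (p i) z) ^ 3) _ _ hg (by rw [evL_apply, h0])
  · refine mem_JJ.2 ⟨h1.mul ((LL_hom _).pow 3), fun j => ?_⟩
    by_cases hj : j = i
    · subst hj; simp [eval_LL, sep_l]
    · simp [h3 j hj]
  · simp [eval_LL, h4, sep_r (hc i)]

lemma extra_unique (hp : GP p) (h : Pencil p f₁ f₂) {z z' : V3} (z1 : eval z f₁ = 0)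
    (z2 : eval z f₂ = 0) (hc : ∀ i, cr (p i) z ≠ 0) (z1' : eval z' f₁ = 0)
    (z2' : eval z' f₂ = 0) (hc' : ∀ i, cr (p i) z' ≠ 0) : cr z z' = 0 := by
  by_contra hzz
  obtain ⟨i, e, h1, h2, h3, h4⟩ := exists_e_ne hp h (ne_of_cr (hc 0)) z1 z2
  have hg : e * LL (sep (p i) z) * LL (sep z' z) ^ 2 ∈ JJ 6 p := by
    refine mem_JJ.2 ⟨(h1.mul (LL_hom _)).mul ((LL_hom _).pow 2), fun j => ?_⟩
    by_cases hj : j = i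
    · subst hj; simp [eval_LL, sep_l]
    · simp [h3 j hj]
  have := ev_I6 z1 z2 (extra_I6 hp h z1' z2' hc' hg (by simp [eval_LL, sep_l]))
  simp [eval_LL, h4, sep_r (hc i), sep_r (cr_symm_ne hzz)] at this

lemma caseA (hp : GP p) (h : Pencil p f₁ f₂) (ht : ∀ i, ¬ NT f₁ f₂ (p i)) : Concl p := by
  refine ⟨WW_finrank_A hp h ht, f₁, h.m1, f₂, h.m2, ?_⟩
  have : ∃ g ∈ WW p, g ∉ W0 p := by
    by_contra! hc
    have h1 := Submodule.finrank_mono (show WW p ≤ W0 p from hc)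
    rw [W0_finrank hp h] at h1
    have := WW_ge (p := p)
    omega
  obtain ⟨g, hg, hg0⟩ := this
  have nz : ∀ z : V3, eval z f₁ = 0 → eval z f₂ = 0 → (∀ i, cr (p i) z ≠ 0) → eval z g ≠ 0 := by
    intro z z1 z2 hc h0
    exact hg0 (WI_le hp h ht ⟨hg, extra_I6 hp h z1 z2 hc (WW_le hg) h0⟩)
  by_cases hex : ∃ z : V3, eval z f₁ = 0 ∧ eval z f₂ = 0 ∧ ∀ i, cr (p i) z ≠ 0
  · obtain ⟨z, z1, z2, hc⟩ := hex
    refine ⟨eval z g • g, (WW p).smul_mem _ hg, ?_, ?_⟩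
    · intro hh
      exact hg0 (((W0 p).smul_mem_iff (nz z z1 z2 hc)).1 hh)
    · refine psd_final hp h ((WW p).smul_mem _ hg)
        (fun i => locB_transv h (hp.ne i) (ht i) ((WW p).smul_mem _ hg)) ?_
      intro z' z1' z2' hc'
      obtain ⟨c, hc0, rfl⟩ := smul_of_cr (ne_of_cr (hc 0)) (ne_of_cr (hc' 0))
        (extra_unique hp h z1 z2 hc z1' z2' hc')
      have n0 := nz z z1 z2 hc
      rw [smul_eq_C_mul, map_mul, eval_C, eval_smul_hom (mem_WW.1 hg).1]
      have : eval z g * (c ^ 6 * eval z g) = c ^ 6 * (eval z g) ^ 2 := by ring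
      rw [this]
      positivity
  · refine ⟨g, hg, hg0, psd_final hp h hg (fun i => locB_transv h (hp.ne i) (ht i) hg) ?_⟩
    intro z z1 z2 hc
    exact absurd ⟨z, z1, z2, hc⟩ hex

end

section

open Filter Topology
variable {p : Fin 8 → V3} {f₁ f₂ : RR}

lemma DD_sq0 {q v : V3} {l : RR} (a : RR) (hl : eval q l = 0) : eval q (DD v (a * l ^ 2)) = 0 := by
  rw [sq, ← mul_assoc, eval_DD_mul, eval_DD_mul, hl]
  simp [hl]

lemma DD_lin0 {q v c : V3} (a : RR) (hl : c ⬝ᵥ q = 0) :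
    eval q (DD v (a * LL c)) = eval q a * (c ⬝ᵥ v) := by
  rw [eval_DD_mul, eval_LL, hl, DD_LL, eval_C]; ring

lemma eval_DDDD_mul (v q : V3) (a b : RR) :
    eval q (DD v (DD v (a * b))) = eval q a * eval q (DD v (DD v b)) +
      2 * eval q (DD v a) * eval q (DD v b) + eval q b * eval q (DD v (DD v a)) := by
  rw [Derivation.leibniz, map_add, map_add, smul_eq_mul, smul_eq_mul, eval_DD_mul, eval_DD_mul]; ring

lemma tri1 (q v : V3) : cr (cr q v) q ⬝ᵥ v = cr q v ⬝ᵥ cr q v := by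
  simp only [dot3, cr0, cr1, cr2]; ring

lemma tri2 (q v : V3) : cr v (cr q v) ⬝ᵥ q = cr q v ⬝ᵥ cr q v := by
  simp only [dot3, cr0, cr1, cr2]; ring

/-- the key tangent direction functional -/
lemma caseB_I6 (hp : GP p) (h : Pencil p f₁ f₂) {i : Fin 8} {v : V3} (hv : cr (p i) v ≠ 0)
    (d1 : eval (p i) (DD v f₁) = 0) (d2 : eval (p i) (DD v f₂) = 0) {g : RR} (hg : g ∈ JJ 6 p)
    (h0 : eval (p i) (DD v g) = 0) : g ∈ I6 f₁ f₂ := by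
  obtain ⟨e, e1, e2, e3⟩ := hp.cubic i
  have N := (dot_self_pos hv).ne'
  apply I6_eq hp h ((evL (p i)).comp (DD v).toLinearMap)
    (fun g hg => by simpa using D_I6 (h.v1 i) (h.v2 i) d1 d2 hg)
    (g' := e * LL (cr v (cr (p i) v)) ^ 2 * LL (cr (cr (p i) v) (p i))) _ _ hg (by simpa using h0)
  · refine mem_JJ.2 ⟨(e1.mul ((LL_hom _).pow 2)).mul (LL_hom _), fun j => ?_⟩
    by_cases hj : j = i
    · subst hj; simp [eval_LL, cr_r]
    · simp [e3 j hj]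
  · have : eval (p i) (DD v (e * LL (cr v (cr (p i) v)) ^ 2 * LL (cr (cr (p i) v) (p i)))) ≠ 0 := by
      rw [DD_lin0 _ (cr_r _ _), tri1]
      simp [eval_LL, tri2, e2, N]
    simpa using this

lemma caseB_extra (hp : GP p) (h : Pencil p f₁ f₂) {i : Fin 8} {v : V3} (hv : cr (p i) v ≠ 0)
    (d1 : eval (p i) (DD v f₁) = 0) (d2 : eval (p i) (DD v f₂) = 0) {z : V3} (z1 : eval z f₁ = 0)
    (z2 : eval z f₂ = 0) (hc : ∀ i, cr (p i) z ≠ 0) : False := by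
  obtain ⟨k, e, h1, h2, h3, h4⟩ := exists_e_ne hp h (ne_of_cr (hc 0)) z1 z2
  have hg : e * LL (sep (p k) z) * LL (sep (p i) z) ^ 2 ∈ JJ 6 p := by
    refine mem_JJ.2 ⟨(h1.mul (LL_hom _)).mul ((LL_hom _).pow 2), fun j => ?_⟩
    by_cases hj : j = k
    · subst hj; simp [eval_LL, sep_l]
    · simp [h3 j hj]
  have := ev_I6 z1 z2 (caseB_I6 hp h hv d1 d2 hg (DD_sq0 _ (by rw [eval_LL, sep_l])))
  simp [eval_LL, h4, sep_r (hc k), sep_r (hc i)] at this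

lemma caseB_other (hp : GP p) (h : Pencil p f₁ f₂) {i : Fin 8} {v : V3} (hv : cr (p i) v ≠ 0)
    (d1 : eval (p i) (DD v f₁) = 0) (d2 : eval (p i) (DD v f₂) = 0) {k : Fin 8} (hk : k ≠ i) :
    ¬ NT f₁ f₂ (p k) := by
  rintro ⟨v', hv', d1', d2'⟩
  obtain ⟨e, h1, h2, h3⟩ := hp.cubic k
  have hg : e * LL (cr (cr (p k) v') (p k)) * LL (sep (p i) (p k)) ^ 2 ∈ JJ 6 p := by
    refine mem_JJ.2 ⟨(h1.mul (LL_hom _)).mul ((LL_hom _).pow 2), fun j => ?_⟩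
    by_cases hj : j = k
    · subst hj; simp [eval_LL, cr_r]
    · simp [h3 j hj]
  have := D_I6 (h.v1 k) (h.v2 k) d1' d2'
    (caseB_I6 hp h hv d1 d2 hg (DD_sq0 _ (by rw [eval_LL, sep_l])))
  rw [mul_right_comm, DD_lin0 _ (cr_r _ _), tri1] at this
  simp [eval_LL, h2, sep_r (hp.np i k hk.symm), (dot_self_pos hv').ne'] at this

lemma caseB_w (hp : GP p) (h : Pencil p f₁ f₂) {i : Fin 8} {v : V3} (hv : cr (p i) v ≠ 0)
    (d1 : eval (p i) (DD v f₁) = 0) (d2 : eval (p i) (DD v f₂) = 0)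
    (w1 : eval (p i) (DD (cr (p i) v) f₁) = 0) (w2 : eval (p i) (DD (cr (p i) v) f₂) = 0) : False := by
  obtain ⟨e, h1, h2, h3⟩ := hp.cubic i
  have hg : e * LL (cr v (cr (p i) v)) ^ 2 * LL (cr (p i) v) ∈ JJ 6 p := by
    refine mem_JJ.2 ⟨(h1.mul ((LL_hom _).pow 2)).mul (LL_hom _), fun j => ?_⟩
    by_cases hj : j = i
    · subst hj; simp [eval_LL, cr_l]
    · simp [h3 j hj]
  have := D_I6 (h.v1 i) (h.v2 i) w1 w2
    (caseB_I6 hp h hv d1 d2 hg (by rw [DD_lin0 _ (cr_l _ _), cr_r, mul_zero]))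
  rw [DD_lin0 _ (cr_l _ _)] at this
  simp [eval_LL, h2, tri2, (dot_self_pos hv).ne'] at this

lemma caseB_second (hp : GP p) (h : Pencil p f₁ f₂) {i : Fin 8} {v : V3} (hv : cr (p i) v ≠ 0)
    (d1 : eval (p i) (DD v f₁) = 0) (d2 : eval (p i) (DD v f₂) = 0)
    (w1 : eval (p i) (DD (cr (p i) v) f₁) ≠ 0) (w2 : eval (p i) (DD (cr (p i) v) f₂) = 0) :
    eval (p i) (DD v (DD v f₂)) ≠ 0 := by
  intro A2
  obtain ⟨e, h1, h2, h3⟩ := hp.cubic i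
  have hg : e * LL (cr v (cr (p i) v)) * LL (cr (cr (p i) v) (p i)) ^ 2 ∈ JJ 6 p := by
    refine mem_JJ.2 ⟨(h1.mul (LL_hom _)).mul ((LL_hom _).pow 2), fun j => ?_⟩
    by_cases hj : j = i
    · subst hj; simp [eval_LL, cr_r]
    · simp [h3 j hj]
  have l0 : eval (p i) (LL (cr (cr (p i) v) (p i))) = 0 := by rw [eval_LL, cr_r]
  have m := caseB_I6 hp h hv d1 d2 hg (DD_sq0 _ l0)
  have mu : ∀ g ∈ I6 f₁ f₂, eval (p i) (DD v (DD v g)) * eval (p i) (DD (cr (p i) v) f₁) =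
      eval (p i) (DD v (DD v f₁)) * eval (p i) (DD (cr (p i) v) g) := by
    intro g hg
    obtain ⟨a, b, -, -, rfl⟩ := mem_I6.1 hg
    simp only [map_add, eval_DDDD_mul, eval_DD_mul, d1, d2, h.v1, h.v2, A2, w2]
    ring
  have := mu _ m
  rw [DD_sq0 _ l0, mul_zero, sq, ← mul_assoc, eval_DDDD_mul, DD_lin0 _ (cr_r _ _), DD_LL, l0, tri1] at this
  simp [eval_LL, h2, tri2, (dot_self_pos hv).ne', w1, ← algebraMap_eq] at this

lemma Pencil.change (h : Pencil p f₁ f₂) {a b : ℝ} (hab : a ^ 2 + b ^ 2 ≠ 0) :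
    Pencil p (a • f₁ + b • f₂) (b • f₁ - a • f₂) := by
  refine ⟨?_, ?_, ?_, ?_⟩
  · exact (JJ 3 p).add_mem ((JJ 3 p).smul_mem _ h.m1) ((JJ 3 p).smul_mem _ h.m2)
  · exact (JJ 3 p).sub_mem ((JJ 3 p).smul_mem _ h.m1) ((JJ 3 p).smul_mem _ h.m2)
  · intro f hf
    obtain ⟨α, β, rfl⟩ := h.spn f hf
    refine ⟨(a * α + b * β) / (a ^ 2 + b ^ 2), (b * α - a * β) / (a ^ 2 + b ^ 2), ?_⟩
    have : ((a * α + b * β) / (a ^ 2 + b ^ 2)) • (a • f₁ + b • f₂) +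
        ((b * α - a * β) / (a ^ 2 + b ^ 2)) • (b • f₁ - a • f₂) =
        (((a * α + b * β) / (a ^ 2 + b ^ 2)) * a + ((b * α - a * β) / (a ^ 2 + b ^ 2)) * b) • f₁ +
        (((a * α + b * β) / (a ^ 2 + b ^ 2)) * b - ((b * α - a * β) / (a ^ 2 + b ^ 2)) * a) • f₂ := by
      module
    rw [this]
    congr 2 <;> field_simp <;> ring
  · intro α β e
    have : (α * a + β * b) • f₁ + (α * b - β * a) • f₂ = 0 := by rw [← e]; module
    obtain ⟨h1, h2⟩ := h.ind _ _ this
    constructor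
    · apply mul_right_cancel₀ hab
      linear_combination a * h1 + b * h2
    · apply mul_right_cancel₀ hab
      linear_combination b * h1 - a * h2

lemma caseB' (hp : GP p) (h : Pencil p f₁ f₂) {i : Fin 8} {v : V3} (hv : cr (p i) v ≠ 0)
    (d1 : eval (p i) (DD v f₁) = 0) (d2 : eval (p i) (DD v f₂) = 0)
    (w1 : eval (p i) (DD (cr (p i) v) f₁) ≠ 0) (w2 : eval (p i) (DD (cr (p i) v) f₂) = 0) :
    Concl p := by
  have A2 := caseB_second hp h hv d1 d2 w1 w2
  obtain ⟨e, h1, h2, h3⟩ := hp.cubic i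
  have sing : ∀ u, eval (p i) (DD u f₂) = 0 := by
    intro u
    obtain ⟨s, x, y, rfl⟩ := decomp hv u
    have E2 := euler h.h2 (p i)
    rw [h.v2, mul_zero] at E2
    simp only [eval_DD', dotProduct_add, dotProduct_smul, smul_eq_mul] at *
    rw [E2, d2, w2]; ring
  have hW : e * f₂ ∈ WW p := by
    refine mem_WW.2 ⟨h1.mul h.h2, fun j u => ?_⟩
    rw [eval_DD_mul]
    by_cases hj : j = i
    · subst hj; rw [sing, h.v2]; ring
    · rw [h3 j hj, h.v2]; ring
  have hle : WW p ≤ W0 p ⊔ Submodule.span ℝ {e * f₂} := by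
    intro g hg
    have hg6 := caseB_I6 hp h hv d1 d2 (WW_le hg) ((mem_WW.1 hg).2 i v)
    obtain ⟨a, b, ha, hb, rfl⟩ := mem_I6.1 hg6
    have o : ∀ j, j ≠ i → eval (p j) a = 0 ∧ eval (p j) b = 0 := by
      intro j hj
      apply not_nt (hp.ne j) h.h1 h.h2 (h.v1 j) (h.v2 j) (caseB_other hp h hv d1 d2 hj)
      intro u
      have := (mem_WW.1 hg).2 j u
      rw [map_add, map_add, eval_DD_mul, eval_DD_mul, h.v1, h.v2] at this
      linarith
    have ai : eval (p i) a = 0 := by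
      have := (mem_WW.1 hg).2 i (cr (p i) v)
      rw [map_add, map_add, eval_DD_mul, eval_DD_mul, h.v1, h.v2, w2] at this
      have : eval (p i) a * eval (p i) (DD (cr (p i) v) f₁) = 0 := by linarith
      exact (mul_eq_zero.1 this).resolve_right w1
    have aJ : a ∈ JJ 3 p := mem_JJ.2 ⟨ha, fun j => by
      by_cases hj : j = i
      · rw [hj, ai]
      · exact (o j hj).1⟩
    have bJ : b - C (eval (p i) b) * e ∈ JJ 3 p := mem_JJ.2 ⟨(HH 3).sub_mem hb (h1.C_mul _), fun j => by
      by_cases hj : j = i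
      · subst hj; simp [h2]
      · simp [h3 j hj, (o j hj).2]⟩
    have : a * f₁ + b * f₂ = (a * f₁ + (b - C (eval (p i) b) * e) * f₂) + (eval (p i) b) • (e * f₂) := by
      rw [smul_eq_C_mul]; ring
    rw [this]
    exact Submodule.add_mem_sup ((W0 p).add_mem (W0_mul aJ h.m1) (W0_mul bJ h.m2))
      (Submodule.smul_mem _ _ (Submodule.mem_span_singleton_self _))
  have hn : e * f₂ ∉ W0 p := by
    intro hc
    have : WW p ≤ W0 p := hle.trans (sup_le le_rfl (by
      rw [Submodule.span_singleton_le_iff_mem]; exact hc))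
    have h1 := Submodule.finrank_mono this
    rw [W0_finrank hp h] at h1
    have := WW_ge (p := p)
    omega
  refine ⟨?_, f₁, h.m1, f₂, h.m2, eval (p i) (DD v (DD v f₂)) • (e * f₂), (WW p).smul_mem _ hW, ?_, ?_⟩
  · have a1 := Submodule.finrank_mono hle
    have a2 := Submodule.finrank_add_le_finrank_add_finrank (W0 p) (Submodule.span ℝ {e * f₂})
    have a3 : Module.finrank ℝ (Submodule.span ℝ {e * f₂}) ≤ 1 :=
      (finrank_span_le_card _).trans (by simp)
    rw [W0_finrank hp h] at a2
    omega
  · intro hh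
    exact hn (((W0 p).smul_mem_iff A2).1 hh)
  · have hW' := (WW p).smul_mem (eval (p i) (DD v (DD v f₂))) hW
    apply psd_final hp h hW'
    · intro j
      by_cases hj : j = i
      · subst hj
        apply locB_lift h.h1 h.h2 (mem_WW.1 hW').1 hv
        apply loc_b (h.v1 j) ((mem_JJ.1 (WW_le hW')).2 j) ((mem_WW.1 hW').2 j) _ d1 w1
        rw [Derivation.map_smul, Derivation.map_smul, smul_eq_C_mul, map_mul, eval_C, eval_DDDD_mul, h2, d2, h.v2]
        have : eval (p j) (DD v (DD v f₂)) * (1 * eval (p j) (DD v (DD v f₂)) + 2 * eval (p j) (DD v e) * 0 +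
          0 * eval (p j) (DD v (DD v e))) = eval (p j) (DD v (DD v f₂)) ^ 2 := by ring
        rw [this]
        positivity
      · exact locB_transv h (hp.ne j) (caseB_other hp h hv d1 d2 hj) hW'
    · intro z z1 z2 hc
      exact (caseB_extra hp h hv d1 d2 z1 z2 hc).elim

lemma concl (hp : GP p) : Concl p := by
  obtain ⟨f₁, f₂, h⟩ := hp.exists_pencil
  by_cases ht : ∀ i, ¬ NT f₁ f₂ (p i)
  · exact caseA hp h ht
  · push Not at ht
    obtain ⟨i, v, hv, d1, d2⟩ := ht
    set c1 := eval (p i) (DD (cr (p i) v) f₁) with hc1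
    set c2 := eval (p i) (DD (cr (p i) v) f₂) with hc2
    have hc : c1 ^ 2 + c2 ^ 2 ≠ 0 := by
      intro hc
      have a1 : c1 = 0 := by nlinarith [sq_nonneg c1, sq_nonneg c2]
      have a2 : c2 = 0 := by nlinarith [sq_nonneg c1, sq_nonneg c2]
      exact caseB_w hp h hv d1 d2 a1 a2
    have ev : ∀ (u : V3) (a b : ℝ), eval (p i) (DD u (a • f₁ + b • f₂)) =
        a * eval (p i) (DD u f₁) + b * eval (p i) (DD u f₂) := by
      intro u a b
      simp [smul_eq_C_mul]
    have ev' : ∀ (u : V3) (a b : ℝ), eval (p i) (DD u (a • f₁ - b • f₂)) =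
        a * eval (p i) (DD u f₁) - b * eval (p i) (DD u f₂) := by
      intro u a b
      simp [smul_eq_C_mul]
    apply caseB' hp (h.change hc) hv
    · rw [ev, d1, d2]; ring
    · rw [ev', d1, d2]; ring
    · rw [ev, ← hc1, ← hc2]
      intro h0; apply hc; linarith
    · rw [ev', ← hc1, ← hc2]; ring

end

section

open Filter Topology

lemma psd_sing {g : RR} {q : V3} (h0 : eval q g = 0) (h : Psd g) (v : V3) : eval q (DD v g) = 0 := by
  obtain ⟨A, B, D, hA, hB, hD, -, H⟩ := expand g q v 0
  by_contra hc
  set d := eval q (DD v g)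
  have H' : ∀ x : ℝ, 0 ≤ x * (d + x * A (x, 0)) := by
    intro x
    have := H (x, 0)
    have h2 := h (q + x • v + (0 : ℝ) • (0 : V3))
    simp only [] at this
    rw [this, h0] at h2
    linarith
  have c : Continuous (fun x : ℝ => d * (d + x * A (x, 0))) := by fun_prop
  have ev := c.continuousAt.eventually_mem (x := 0) (Ioi_mem_nhds (by
    rw [zero_mul, add_zero]; exact mul_self_pos.2 hc : 0 < d * (d + 0 * A (0, 0))))
  obtain ⟨ε, hε, hb⟩ := Metric.eventually_nhds_iff.1 ev
  have hx := hb (y := - (ε / 2) * (d / |d|)) (by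
    rw [dist_zero_right, Real.norm_eq_abs, abs_mul, abs_neg, abs_div d, abs_abs,
      div_self (abs_pos.2 hc).ne', abs_of_pos (by positivity)]
    linarith)
  have h1 := H' (- (ε / 2) * (d / |d|))
  simp only [Set.mem_Ioi] at hx
  set Y := d + - (ε / 2) * (d / |d|) * A (- (ε / 2) * (d / |d|), 0)
  have : - (ε / 2) * (d / |d|) * Y = -(ε / 2 / |d| * (d * Y)) := by ring
  rw [this] at h1
  have := abs_pos.2 hc
  have : 0 < ε / 2 / |d| * (d * Y) := by positivity
  linarith

section
variable {T : Set P2} (e : Fin 8 ≃ T)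

/-- representatives -/
def rp (i : Fin 8) : V3 := (e i).1.rep

lemma rp_all {Q : V3 → Prop} : (∀ P ∈ T, Q P.rep) ↔ ∀ i, Q (rp e i) := by
  constructor
  · intro h i
    exact h _ (e i).2
  · intro h P hP
    have := h (e.symm ⟨P, hP⟩)
    simpa [rp] using this

lemma rp_card {Q : V3 → Prop} {n : ℕ} (h : {P ∈ T | Q P.rep}.encard ≤ n) (s : Finset (Fin 8))
    (hs : ∀ i ∈ s, Q (rp e i)) : s.card ≤ n := by
  have inj : Function.Injective (fun i => (e i).1) := Subtype.val_injective.comp e.injective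
  have h1 : (Set.image (fun i => (e i).1) (s : Set (Fin 8))).encard ≤ {P ∈ T | Q P.rep}.encard := by
    apply Set.encard_le_encard
    rintro P ⟨i, hi, rfl⟩
    exact ⟨(e i).2, hs i hi⟩
  rw [inj.encard_image, Set.encard_coe_eq_coe_finsetCard] at h1
  exact_mod_cast h1.trans h

lemma rp_GP (h : GenPos T) : GP (rp e) := by
  refine ⟨?_, ?_, ?_⟩
  · intro i j hij h0
    apply hij
    obtain ⟨c, hc, hcc⟩ := smul_of_cr (e i).1.rep_nonzero (e j).1.rep_nonzero h0
    apply e.injective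
    apply Subtype.ext
    rw [← (e i).1.mk_rep, ← (e j).1.mk_rep]
    symm
    rw [Projectivization.mk_eq_mk_iff']
    exact ⟨c, hcc.symm⟩
  · intro l hl hl1 s hs
    exact rp_card e (Q := fun u => eval u l = 0) (h.1 l hl hl1) s hs
  · intro l hl hl1 s hs
    exact rp_card e (Q := fun u => eval u l = 0) (h.2 l hl hl1) s hs

lemma rp_Isub (d : ℕ) : Isub d T = JJ d (rp e) := by
  ext f
  rw [mem_JJ]
  exact and_congr Iff.rfl (rp_all e (Q := fun u => eval u f = 0))

lemma rp_Isub2 : Isub2 6 T = WW (rp e) := by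
  ext f
  rw [mem_WW']
  constructor
  · rintro ⟨h1, h2⟩
    exact ⟨h1, fun i j => (h2 _ (e i).2).2 j⟩
  · intro h
    have h3 := (mem_JJ.1 (WW_le (mem_WW'.2 h))).2
    exact ⟨h.1, (rp_all e (Q := fun u => eval u f = 0 ∧ ∀ j, eval u (pderiv j f) = 0)).2
      fun i => ⟨h3 i, h.2 i⟩⟩

lemma rp_Isq : IsqCubic T = W0 (rp e) := by
  unfold IsqCubic W0
  rw [rp_Isub e]

end

variable {p : Fin 8 → V3}

/-- squares of cubics lie in the cone -/
lemma sq_facts {f : RR} (hf : f ∈ JJ 3 p) : (f ^ 2).IsHomogeneous 6 ∧ Psd (f ^ 2) ∧ Sos (f ^ 2) ∧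
    ∀ i, eval (p i) (f ^ 2) = 0 := by
  obtain ⟨h1, h2⟩ := mem_JJ.1 hf
  refine ⟨h1.pow 2, fun u => ?_, ⟨1, fun _ => f, by simp⟩, fun i => by simp [h2 i]⟩
  rw [map_pow]; positivity

lemma W0_le_span {S : Set RR} (hS : ∀ f ∈ JJ 3 p, f ^ 2 ∈ S) : W0 p ≤ Submodule.span ℝ S := by
  apply Submodule.span_le.2
  rintro g ⟨a, ha, b, hb, rfl⟩
  have : a * b = (1 / 4 : ℝ) • ((a + b) ^ 2 - (a - b) ^ 2) := by
    have : (a + b) ^ 2 - (a - b) ^ 2 = (4 : ℝ) • (a * b) := by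
      rw [smul_eq_C_mul, map_ofNat]; ring
    rw [this, smul_smul]; norm_num
  rw [this]
  exact Submodule.smul_mem _ _ (Submodule.sub_mem _
    (Submodule.subset_span (hS _ ((JJ 3 p).add_mem ha hb)))
    (Submodule.subset_span (hS _ ((JJ 3 p).sub_mem ha hb))))

lemma spanSos : Submodule.span ℝ {g : RR |
    g.IsHomogeneous 6 ∧ Psd g ∧ Sos g ∧ ∀ i, eval (p i) g = 0} = W0 p := by
  apply le_antisymm
  · apply Submodule.span_le.2
    rintro g ⟨h6, -, ⟨n, h, e⟩, hv⟩
    have hh := sos_hom h6 h e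
    rw [e]
    apply Submodule.sum_mem
    intro i _
    rw [sq]
    have hm : h i ∈ JJ 3 p := by
      refine mem_JJ.2 ⟨hh i, fun j => ?_⟩
      have := hv j
      rw [e, map_sum] at this
      simp only [map_pow] at this
      rw [Finset.sum_eq_zero_iff_of_nonneg (fun i _ => sq_nonneg _)] at this
      exact pow_eq_zero_iff two_ne_zero |>.1 (this i (Finset.mem_univ i))
    exact W0_mul hm hm
  · exact W0_le_span fun f hf => sq_facts hf

lemma spanPsd (hp : GP p) : Submodule.span ℝ {g : RR |
    g.IsHomogeneous 6 ∧ Psd g ∧ ∀ i, eval (p i) g = 0} = WW p := by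
  apply le_antisymm
  · apply Submodule.span_le.2
    rintro g ⟨h6, hg, hv⟩
    exact mem_WW.2 ⟨h6, fun i v => psd_sing (hv i) hg v⟩
  · obtain ⟨h4, f₁, m1, f₂, m2, g, hg, hg0, M, hM⟩ := concl hp
    obtain ⟨k₁, k₂, hk⟩ := hp.exists_pencil
    set S := Submodule.span ℝ {g : RR | g.IsHomogeneous 6 ∧ Psd g ∧ ∀ i, eval (p i) g = 0}
    have hW : W0 p ≤ S := W0_le_span fun f hf => by
      obtain ⟨a, b, -, c⟩ := sq_facts hf
      exact ⟨a, b, c⟩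
    have hs : C M * (f₁ ^ 2 + f₂ ^ 2) ∈ W0 p := by
      rw [← smul_eq_C_mul, sq, sq]
      exact (W0 p).smul_mem _ ((W0 p).add_mem (W0_mul m1 m1) (W0_mul m2 m2))
    have hgS : g ∈ S := by
      have h1 : C M * (f₁ ^ 2 + f₂ ^ 2) + g ∈ S := by
        apply Submodule.subset_span
        have := WW_le ((WW p).add_mem (W0_le hs) hg)
        rw [mem_JJ] at this
        exact ⟨this.1, hM, this.2⟩
      have := S.sub_mem h1 (hW hs)
      rwa [add_sub_cancel_left] at this
    have hlt : W0 p < W0 p ⊔ Submodule.span ℝ {g} := by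
      refine lt_of_le_of_ne le_sup_left fun e => hg0 ?_
      rw [e]
      exact Submodule.mem_sup_right (Submodule.mem_span_singleton_self g)
    have hle : W0 p ⊔ Submodule.span ℝ {g} ≤ WW p :=
      sup_le W0_le (by rw [Submodule.span_singleton_le_iff_mem]; exact hg)
    have h5 := Submodule.finrank_lt_finrank_of_lt hlt
    rw [W0_finrank hp hk] at h5
    have := Submodule.eq_of_le_of_finrank_le hle (by omega)
    rw [← this]
    exact sup_le hW (by rw [Submodule.span_singleton_le_iff_mem]; exact hgS)

end

theorem statement1 (T : Set P2) (hT8 : T.encard = 8) (hgen : GenPos T) :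
    Submodule.span ℝ {g : MvPolynomial (Fin 3) ℝ |
        g.IsHomogeneous 6 ∧ Psd g ∧ ∀ P ∈ T, VanishAt g P} = Isub2 6 T ∧
    Module.finrank ℝ (Isub2 6 T) = 4 ∧
    Submodule.span ℝ {g : MvPolynomial (Fin 3) ℝ |
        g.IsHomogeneous 6 ∧ Psd g ∧ Sos g ∧ ∀ P ∈ T, VanishAt g P} = IsqCubic T ∧
    Module.finrank ℝ (IsqCubic T) = 3 := by
  have hc : Nat.card T = 8 := by
    rw [Nat.card_coe_set_eq, Set.ncard, hT8]; rfl
  have : Finite T := Nat.finite_of_card_ne_zero (by omega)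
  let e : Fin 8 ≃ T := (Finite.equivFinOfCardEq hc).symm
  have hp := rp_GP e hgen
  have hv : ∀ g : MvPolynomial (Fin 3) ℝ, (∀ P ∈ T, VanishAt g P) ↔ ∀ i, eval (rp e i) g = 0 :=
    fun g => rp_all e (Q := fun u => eval u g = 0)
  obtain ⟨k₁, k₂, hk⟩ := hp.exists_pencil
  simp only [hv]
  rw [rp_Isub2 e, rp_Isq e]
  exact ⟨spanPsd hp, le_antisymm (concl hp).1 WW_ge, spanSos, W0_finrank hp hk⟩

end
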